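/- arXiv:1307.2718 — 3 statements merged into one kernel-verified Lean document; each statement's English description precedes it below -/
import Mathlib

section
/- Let q be a power of a prime p, let d ≥ 2 be an integer, let s = gcd(q−1, d−1), and let φ denote Euler's totient function. If p does not divide d, then N_d(q) ≤ q^{d−1} + (s−1)·q^{d−1−φ(d−1)}. If p divides d, then N_d(q) ≤ q^{d−1} + (s−1)·q^{d−1−φ(d−1)} + (q−1)·q^{d/p−1}. -/
/-- The relation on polynomials of degree exactly `d` over `F`:
`f ~ g` iff the functional graphs of the induced maps are isomorphic, i.e.
there is a bijection `σ` with `σ ∘ f = g ∘ σ`. -/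
def polyFunRel (F : Type*) [Field F] (d : ℕ)
    (f g : {f : Polynomial F // f.natDegree = d}) : Prop :=
  ∃ σ : F ≃ F,
    ⇑σ ∘ (fun x => Polynomial.eval x f.1) = (fun x => Polynomial.eval x g.1) ∘ ⇑σ

/-- `N_d(q)`: the number of isomorphism classes of functional graphs of maps
`x ↦ f(x)` as `f` ranges over polynomials of degree exactly `d` over `F`. -/
noncomputable def numFunctionalGraphs (F : Type*) [Field F] (d : ℕ) : ℕ :=
  Nat.card (Quot (polyFunRel F d))

open Polynomial

/-- The affine bijection `x ↦ scale * x + shift` of a field. -/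
@[ext]
structure AffineTransformation (F : Type*) [Field F] where
  /-- The linear coefficient. -/
  scale : Fˣ
  /-- The constant coefficient. -/
  shift : F

namespace AffineTransformation

variable {F : Type*} [Field F]

instance : Mul (AffineTransformation F) :=
  ⟨fun g h => ⟨g.scale * h.scale, g.scale * h.shift + g.shift⟩⟩

instance : One (AffineTransformation F) := ⟨⟨1, 0⟩⟩

instance : Inv (AffineTransformation F) :=
  ⟨fun g => ⟨g.scale⁻¹, -((g.scale⁻¹ : Fˣ) * g.shift)⟩⟩

@[simp] lemma mul_scale (g h : AffineTransformation F) : (g * h).scale = g.scale * h.scale := rfl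

@[simp] lemma mul_shift (g h : AffineTransformation F) :
    (g * h).shift = g.scale * h.shift + g.shift := rfl

@[simp] lemma one_scale : (1 : AffineTransformation F).scale = 1 := rfl

@[simp] lemma one_shift : (1 : AffineTransformation F).shift = 0 := rfl

@[simp] lemma inv_scale (g : AffineTransformation F) : g⁻¹.scale = g.scale⁻¹ := rfl

@[simp] lemma inv_shift (g : AffineTransformation F) :
    g⁻¹.shift = -((g.scale⁻¹ : Fˣ) * g.shift) := rfl

instance : Group (AffineTransformation F) :=
  Group.ofLeftAxioms
    (fun g h k => by ext <;> simp [mul_assoc, mul_add, add_assoc])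
    (fun g => by ext <;> simp)
    (fun g => by ext <;> simp)

/-- An affine transformation is the pair of its coefficients. -/
def equivProd : AffineTransformation F ≃ Fˣ × F where
  toFun g := (g.scale, g.shift)
  invFun x := ⟨x.1, x.2⟩

/-- The linear polynomial inducing an affine transformation. -/
noncomputable def toPolynomial (g : AffineTransformation F) : F[X] :=
  C (g.scale : F) * X + C g.shift

lemma toPolynomial_comp (g h : AffineTransformation F) :
    g.toPolynomial.comp h.toPolynomial = (g * h).toPolynomial := by
  simp [toPolynomial]
  ring

@[simp] lemma toPolynomial_one : (1 : AffineTransformation F).toPolynomial = X := by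
  simp [toPolynomial]

@[simp] lemma natDegree_toPolynomial (g : AffineTransformation F) :
    g.toPolynomial.natDegree = 1 :=
  natDegree_linear g.scale.ne_zero

@[simp] lemma leadingCoeff_toPolynomial (g : AffineTransformation F) :
    g.toPolynomial.leadingCoeff = g.scale :=
  leadingCoeff_linear g.scale.ne_zero

/-- Affine transformations act on the polynomials of a given degree by conjugation. -/
noncomputable instance (d : ℕ) :
    MulAction (AffineTransformation F) {f : F[X] // f.natDegree = d} where
  smul g f := ⟨(g.toPolynomial.comp f.1).comp g⁻¹.toPolynomial, by simp [natDegree_comp, f.2]⟩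
  one_smul f := Subtype.ext <| by
    change ((1 : AffineTransformation F).toPolynomial.comp f.1).comp
      (1⁻¹ : AffineTransformation F).toPolynomial = f.1
    simp
  mul_smul g h f := Subtype.ext <| by
    change ((g * h).toPolynomial.comp f.1).comp (g * h)⁻¹.toPolynomial =
      (g.toPolynomial.comp ((h.toPolynomial.comp f.1).comp h⁻¹.toPolynomial)).comp
        g⁻¹.toPolynomial
    rw [mul_inv_rev, ← toPolynomial_comp, ← toPolynomial_comp]
    simp only [comp_assoc]

lemma smul_val {d : ℕ} (g : AffineTransformation F) (f : {f : F[X] // f.natDegree = d}) :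
    (g • f).1 = (g.toPolynomial.comp f.1).comp g⁻¹.toPolynomial := rfl

lemma smul_comp {d : ℕ} (g : AffineTransformation F) (f : {f : F[X] // f.natDegree = d}) :
    (g • f).1.comp g.toPolynomial = g.toPolynomial.comp f.1 := by
  rw [smul_val, comp_assoc, toPolynomial_comp, inv_mul_cancel, toPolynomial_one, comp_X]

lemma comp_eq_of_smul_eq {d : ℕ} {g : AffineTransformation F}
    {f : {f : F[X] // f.natDegree = d}} (h : g • f = f) :
    f.1.comp g.toPolynomial = C (g.scale : F) * f.1 + C g.shift := by
  have := smul_comp g f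
  rw [h] at this
  simpa [toPolynomial] using this

lemma polyFunRel_smul {d : ℕ} (g : AffineTransformation F)
    (f : {f : F[X] // f.natDegree = d}) : polyFunRel F d f (g • f) := by
  have inv_eval (k : AffineTransformation F) (x : F) :
      k⁻¹.toPolynomial.eval (k.toPolynomial.eval x) = x := by
    rw [← eval_comp, toPolynomial_comp, inv_mul_cancel, toPolynomial_one, eval_X]
  refine ⟨⟨fun x => g.toPolynomial.eval x, fun x => g⁻¹.toPolynomial.eval x, inv_eval g,
    fun x => by simpa using inv_eval g⁻¹ x⟩, ?_⟩
  funext x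
  change g.toPolynomial.eval (f.1.eval x) = (g • f).1.eval (g.toPolynomial.eval x)
  rw [← eval_comp, ← eval_comp, smul_comp]

lemma scale_pow_natDegree {g : AffineTransformation F} {f : F[X]} {c : F} (hf : f ≠ 0)
    (h : f.comp g.toPolynomial = C (g.scale : F) * f + C c) (hc : c = 0 ∨ 2 ≤ f.natDegree) :
    g.scale ^ f.natDegree = g.scale := by
  have key := coeff_comp_degree_mul_degree (p := f) (q := g.toPolynomial) (by simp)
  have hC : (C c).coeff f.natDegree = 0 := by
    rcases hc with rfl | hc
    · simp
    · exact coeff_C_of_ne_zero (by omega)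
  rw [h, natDegree_toPolynomial, mul_one, coeff_add, hC, coeff_C_mul, coeff_natDegree, add_zero,
    leadingCoeff_toPolynomial, mul_comm] at key
  exact Units.ext (by simpa using (mul_left_cancel₀ (leadingCoeff_ne_zero.2 hf) key).symm)

lemma natDegree_cast_eq_zero {g : AffineTransformation F} {f : F[X]} {c : F} (hf : f ≠ 0)
    (h : f.comp g.toPolynomial = C (g.scale : F) * f + C c) (hc : c = 0 ∨ 2 ≤ f.natDegree)
    (hscale : g.scale = 1) (hshift : g.shift ≠ 0) : (f.natDegree : F) = 0 := by
  obtain hn | ⟨n, hn⟩ : f.natDegree = 0 ∨ ∃ n, f.natDegree = n + 1 :=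
    (Nat.eq_zero_or_eq_succ_pred _).imp_right fun h => ⟨_, h⟩
  · simp [hn]
  have hC : (C c).coeff n = 0 := by
    rcases hc with rfl | hc
    · simp
    · exact coeff_C_of_ne_zero (by omega)
  have hcoeff : (taylor g.shift f).coeff n = f.coeff n := by
    have : g.toPolynomial = X + C g.shift := by simp [toPolynomial, hscale]
    rw [taylor_apply, ← this, h]
    simp [hscale, hC]
  have hdeg : (hasseDeriv n f).natDegree < 2 :=
    (natDegree_hasseDeriv_le f n).trans_lt (by omega)
  rw [taylor_coeff, eval_eq_sum_range' hdeg] at hcoeff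
  simp only [Finset.sum_range_succ, Finset.sum_range_zero, hasseDeriv_coeff] at hcoeff
  have hlead : f.coeff (1 + n) ≠ 0 := by
    have : f.coeff f.natDegree ≠ 0 := leadingCoeff_ne_zero.2 hf
    rwa [hn, add_comm] at this
  have hchoose : (1 + n).choose n = 1 + n := by
    rw [add_comm, Nat.choose_succ_self_right]
  rw [hchoose] at hcoeff
  have : ((1 + n : ℕ) : F) * (f.coeff (1 + n) * g.shift) = 0 := by
    simpa [mul_assoc] using hcoeff
  rw [hn, add_comm]
  exact (mul_eq_zero.1 this).resolve_right (mul_ne_zero hlead hshift)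

/-- Polynomials of degree `d` in a set are determined by their coefficients of index in
`insert d T` if the degrees of their differences belong to `insert d T`. -/
lemma card_le_of_natDegree_sub_mem [Fintype F] {d : ℕ} (T : Finset ℕ) (hd : 0 < d)
    (S : Set {f : F[X] // f.natDegree = d})
    (hS : ∀ f₁ ∈ S, ∀ f₂ ∈ S, f₁.1 - f₂.1 ≠ 0 → (f₁.1 - f₂.1).natDegree ∈ insert d T) :
    Nat.card S ≤ (Fintype.card F - 1) * Fintype.card F ^ T.card := by
  classical
  let Φ : S → Fˣ × (T → F) := fun f =>
    (Units.mk0 f.1.1.leadingCoeff (leadingCoeff_ne_zero.2 fun h => by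
      have := f.1.2
      simp [h] at this
      omega), fun i => f.1.1.coeff i)
  have hΦ : Function.Injective Φ := by
    intro f₁ f₂ h
    have hlead : f₁.1.1.coeff d = f₂.1.1.coeff d := by
      have := congrArg (fun x => (x.1 : F)) h
      simpa [Φ, leadingCoeff, f₁.1.2, f₂.1.2] using this
    by_contra hne
    have hsub : f₁.1.1 - f₂.1.1 ≠ 0 :=
      sub_ne_zero.2 fun h => hne (Subtype.ext (Subtype.ext h))
    refine leadingCoeff_ne_zero.2 hsub ?_
    rw [leadingCoeff, coeff_sub, sub_eq_zero]
    rcases Finset.mem_insert.1 (hS _ f₁.2 _ f₂.2 hsub) with hdeg | hdeg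
    · rw [hdeg, hlead]
    · exact congrFun (congrArg Prod.snd h) ⟨_, hdeg⟩
  refine (Nat.card_le_card_of_injective Φ hΦ).trans_eq ?_
  simp [Fintype.card_units]

instance finite_natDegree_eq [Finite F] (d : ℕ) : Finite {f : F[X] // f.natDegree = d} := by
  refine Finite.of_injective (fun f (i : Fin (d + 1)) => f.1.coeff i) fun f₁ f₂ h => ?_
  refine Subtype.ext (Polynomial.ext fun i => ?_)
  by_cases hi : i < d + 1
  · exact congrFun h ⟨i, hi⟩
  · rw [coeff_eq_zero_of_natDegree_lt (by omega), coeff_eq_zero_of_natDegree_lt (by omega)]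

section FixedPoints

variable {d : ℕ} {g : AffineTransformation F}

lemma comp_sub_of_mem_fixedBy {f₁ f₂ : {f : F[X] // f.natDegree = d}}
    (h₁ : f₁ ∈ MulAction.fixedBy {f : F[X] // f.natDegree = d} g)
    (h₂ : f₂ ∈ MulAction.fixedBy {f : F[X] // f.natDegree = d} g) :
    (f₁.1 - f₂.1).comp g.toPolynomial = C (g.scale : F) * (f₁.1 - f₂.1) + C 0 := by
  rw [sub_comp, comp_eq_of_smul_eq h₁, comp_eq_of_smul_eq h₂, C_0]
  ring

lemma natDegree_sub_le (f₁ f₂ : {f : F[X] // f.natDegree = d}) :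
    (f₁.1 - f₂.1).natDegree ≤ d :=
  (Polynomial.natDegree_sub_le _ _).trans (by simp [f₁.2, f₂.2])

lemma ne_zero_of_natDegree_eq (hd : 2 ≤ d) (f : {f : F[X] // f.natDegree = d}) : f.1 ≠ 0 := by
  intro h
  have := f.2
  simp [h] at this
  omega

lemma card_fixedBy_eq_zero_of_translation {p : ℕ} [CharP F p] (hd : 2 ≤ d) (hpd : ¬ p ∣ d)
    (hscale : g.scale = 1) (hshift : g.shift ≠ 0) :
    Nat.card (MulAction.fixedBy {f : F[X] // f.natDegree = d} g) = 0 := by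
  have : IsEmpty (MulAction.fixedBy {f : F[X] // f.natDegree = d} g) := by
    refine ⟨fun f => hpd ?_⟩
    have := natDegree_cast_eq_zero (ne_zero_of_natDegree_eq hd f.1) (comp_eq_of_smul_eq f.2)
      (.inr (by rw [f.1.2]; exact hd)) hscale hshift
    rwa [f.1.2, CharP.cast_eq_zero_iff F p] at this
  exact Nat.card_of_isEmpty

lemma card_fixedBy_eq_zero_of_scale_pow_ne_one (hd : 2 ≤ d) (hscale : g.scale ^ (d - 1) ≠ 1) :
    Nat.card (MulAction.fixedBy {f : F[X] // f.natDegree = d} g) = 0 := by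
  have : IsEmpty (MulAction.fixedBy {f : F[X] // f.natDegree = d} g) := by
    refine ⟨fun f => hscale ?_⟩
    have := scale_pow_natDegree (ne_zero_of_natDegree_eq hd f.1) (comp_eq_of_smul_eq f.2)
      (.inr (by rw [f.1.2]; exact hd))
    rw [f.1.2, show d = d - 1 + 1 by omega, pow_succ] at this
    simpa using this
  exact Nat.card_of_isEmpty

variable [Fintype F]

lemma card_fixedBy_le (hd : 2 ≤ d) :
    Nat.card (MulAction.fixedBy {f : F[X] // f.natDegree = d} g) ≤
      (Fintype.card F - 1) * Fintype.card F ^ d := by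
  have := (card_le_of_natDegree_sub_mem (Finset.range d) (by omega)
    (MulAction.fixedBy {f : F[X] // f.natDegree = d} g) fun f₁ _ f₂ _ _ => by
      have := natDegree_sub_le f₁ f₂
      simp only [Finset.mem_insert, Finset.mem_range]
      omega)
  simpa using this

lemma card_fixedBy_le_of_translation {p : ℕ} [CharP F p] (hp : 0 < p) (hd : 2 ≤ d) (hpd : p ∣ d)
    (hscale : g.scale = 1) (hshift : g.shift ≠ 0) :
    Nat.card (MulAction.fixedBy {f : F[X] // f.natDegree = d} g) ≤
      (Fintype.card F - 1) * Fintype.card F ^ (d / p) := by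
  have hcard := (card_le_of_natDegree_sub_mem ((Finset.range (d / p)).image (p * ·)) (by omega)
    (MulAction.fixedBy {f : F[X] // f.natDegree = d} g) fun f₁ h₁ f₂ h₂ hne => by
      have hdeg := natDegree_sub_le f₁ f₂
      have hzero := natDegree_cast_eq_zero hne (comp_sub_of_mem_fixedBy h₁ h₂) (.inl rfl)
        hscale hshift
      obtain ⟨k, hk⟩ := (CharP.cast_eq_zero_iff F p _).1 hzero
      obtain ⟨m, rfl⟩ := hpd
      rw [hk] at hdeg ⊢
      rw [Nat.mul_div_cancel_left _ hp]
      rcases (Nat.le_of_mul_le_mul_left hdeg hp).eq_or_lt with rfl | hlt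
      · exact Finset.mem_insert_self _ _
      · exact Finset.mem_insert_of_mem
          (Finset.mem_image_of_mem _ (Finset.mem_range.2 hlt)))
  refine hcard.trans (Nat.mul_le_mul_left _ (Nat.pow_le_pow_right Fintype.card_pos ?_))
  simpa using Finset.card_image_le (s := Finset.range (d / p)) (f := (p * ·))

lemma card_fixedBy_le_of_scale_ne_one (hd : 2 ≤ d) (hscale : g.scale ≠ 1)
    (hpow : g.scale ^ (d - 1) = 1) :
    Nat.card (MulAction.fixedBy {f : F[X] // f.natDegree = d} g) ≤
      (Fintype.card F - 1) * Fintype.card F ^ (d - 1 - Nat.totient (d - 1)) := by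
  have hcard := (card_le_of_natDegree_sub_mem
    (((Finset.range (d - 1)).filter fun i => ¬ (d - 1).Coprime i).image (· + 1)) (by omega)
    (MulAction.fixedBy {f : F[X] // f.natDegree = d} g) fun f₁ h₁ f₂ h₂ hne => by
      have hdeg := natDegree_sub_le f₁ f₂
      have hfix := scale_pow_natDegree hne (comp_sub_of_mem_fixedBy h₁ h₂) (.inl rfl)
      generalize (f₁.1 - f₂.1).natDegree = n at hdeg hfix ⊢
      rcases hdeg.eq_or_lt with rfl | hlt
      · exact Finset.mem_insert_self _ _
      refine Finset.mem_insert_of_mem (Finset.mem_image.2 ?_)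
      rcases n with _ | n
      · exact absurd (by simpa using hfix.symm) hscale
      refine ⟨n, Finset.mem_filter.2 ⟨Finset.mem_range.2 (by omega), fun hcop => hscale ?_⟩, rfl⟩
      have hn : g.scale ^ n = 1 := by simpa [pow_succ] using hfix
      have := pow_gcd_eq_one.2 ⟨hpow, hn⟩
      rwa [hcop, pow_one] at this)
  refine hcard.trans (Nat.mul_le_mul_left _ (Nat.pow_le_pow_right Fintype.card_pos ?_))
  refine Finset.card_image_le.trans (Nat.le_sub_of_add_le ?_)
  rw [Nat.totient, add_comm, Finset.card_filter_add_card_filter_not, Finset.card_range]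

end FixedPoints

lemma card_scale_le [Fintype F] [DecidableEq F] {n : ℕ} (hn : 0 < n) :
    ((Finset.univ.erase (1 : Fˣ)).filter fun a => a ^ n = 1).card ≤
      Nat.gcd (Fintype.card F - 1) n - 1 := by
  have hle := IsCyclic.card_pow_eq_one_le (α := Fˣ)
    (Nat.gcd_pos_of_pos_right (Fintype.card F - 1) hn)
  have hsub : ((Finset.univ.erase (1 : Fˣ)).filter fun a => a ^ n = 1) ⊆
      (Finset.univ.filter fun a : Fˣ => a ^ Nat.gcd (Fintype.card F - 1) n = 1).erase 1 := by
    intro a ha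
    simp only [Finset.mem_filter, Finset.mem_erase, Finset.mem_univ, and_true, true_and] at ha ⊢
    refine ⟨ha.1, pow_gcd_eq_one.2 ⟨?_, ha.2⟩⟩
    rw [← Fintype.card_units, pow_card_eq_one]
  refine (Finset.card_le_card hsub).trans ?_
  rw [Finset.card_erase_of_mem (by simp)]
  exact Nat.sub_le_sub_right hle 1

lemma numFunctionalGraphs_le_card_orbits [Finite F] (d : ℕ) :
    numFunctionalGraphs F d ≤ Nat.card (Quotient
      (MulAction.orbitRel (AffineTransformation F) {f : F[X] // f.natDegree = d})) := by
  refine Nat.card_le_card_of_surjective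
    (Quotient.lift (Quot.mk (polyFunRel F d)) fun f₁ f₂ h => ?_) fun x => ?_
  · obtain ⟨g, rfl⟩ := h
    exact (Quot.sound (polyFunRel_smul g f₂)).symm
  · obtain ⟨f, rfl⟩ := Quot.exists_rep x
    exact ⟨Quotient.mk _ f, rfl⟩

/-- Burnside's lemma for the conjugation action, with the fixed points of nontrivial translations
bounded by `B`. -/
lemma numFunctionalGraphs_mul_card_le [Fintype F] {d B : ℕ} (hd : 2 ≤ d)
    (hB : ∀ g : AffineTransformation F, g.scale = 1 → g.shift ≠ 0 →
      Nat.card (MulAction.fixedBy {f : F[X] // f.natDegree = d} g) ≤ (Fintype.card F - 1) * B) :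
    numFunctionalGraphs F d * ((Fintype.card F - 1) * Fintype.card F) ≤
      (Fintype.card F - 1) * (Fintype.card F ^ d + (Fintype.card F - 1) * B +
        (Nat.gcd (Fintype.card F - 1) (d - 1) - 1) *
          (Fintype.card F * Fintype.card F ^ (d - 1 - Nat.totient (d - 1)))) := by
  classical
  let q := Fintype.card F
  let V := {f : F[X] // f.natDegree = d}
  let E := q ^ (d - 1 - Nat.totient (d - 1))
  let fix (a : Fˣ) (b : F) : ℕ :=
    Nat.card (MulAction.fixedBy V (⟨a, b⟩ : AffineTransformation F))
  let : Fintype (AffineTransformation F) := Fintype.ofEquiv _ equivProd.symm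
  let (g : AffineTransformation F) : Fintype (MulAction.fixedBy V g) := Fintype.ofFinite _
  let : Fintype (Quotient (MulAction.orbitRel (AffineTransformation F) V)) := Fintype.ofFinite _
  have hcard : Fintype.card (AffineTransformation F) = (q - 1) * q := by
    rw [Fintype.card_congr equivProd, Fintype.card_prod, Fintype.card_units]
  have hburnside := MulAction.sum_card_fixedBy_eq_card_orbits_mul_card_group
    (AffineTransformation F) V
  rw [hcard, ← Nat.card_eq_fintype_card] at hburnside
  have hsum : ∑ g : AffineTransformation F, Fintype.card (MulAction.fixedBy V g) =
      ∑ a : Fˣ, ∑ b : F, fix a b := by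
    rw [← Fintype.sum_prod_type', ← equivProd.symm.sum_comp]
    exact Finset.sum_congr rfl fun x _ => Nat.card_eq_fintype_card.symm
  have htrans : ∑ b : F, fix 1 b ≤ (q - 1) * q ^ d + (q - 1) * ((q - 1) * B) := by
    rw [← Finset.add_sum_erase _ _ (Finset.mem_univ (0 : F))]
    refine add_le_add (card_fixedBy_le hd) ?_
    refine (Finset.sum_le_card_nsmul _ _ ((q - 1) * B) fun b hb =>
      hB _ rfl (Finset.ne_of_mem_erase hb)).trans_eq ?_
    simp [q, Finset.card_erase_of_mem]
  have hscale : ∑ a ∈ Finset.univ.erase (1 : Fˣ), ∑ b : F, fix a b ≤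
      (Nat.gcd (q - 1) (d - 1) - 1) * (q * ((q - 1) * E)) := by
    rw [← Finset.sum_filter_of_ne (p := fun a => a ^ (d - 1) = 1)]
    · refine (Finset.sum_le_card_nsmul _ _ (q * ((q - 1) * E)) fun a ha => ?_).trans
        (Nat.mul_le_mul_right _ (card_scale_le (by omega)))
      obtain ⟨ha, hpow⟩ := Finset.mem_filter.1 ha
      refine (Finset.sum_le_card_nsmul _ _ ((q - 1) * E) fun b _ =>
        card_fixedBy_le_of_scale_ne_one hd (Finset.ne_of_mem_erase ha) hpow).trans_eq ?_
      simp [q]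
    · intro a _ hne
      by_contra hpow
      exact hne (Finset.sum_eq_zero fun b _ => card_fixedBy_eq_zero_of_scale_pow_ne_one hd hpow)
  calc numFunctionalGraphs F d * ((q - 1) * q)
      ≤ ∑ a : Fˣ, ∑ b : F, fix a b := by
        rw [← hsum, hburnside]
        exact Nat.mul_le_mul_right _ (numFunctionalGraphs_le_card_orbits d)
    _ ≤ ((q - 1) * q ^ d + (q - 1) * ((q - 1) * B)) +
          (Nat.gcd (q - 1) (d - 1) - 1) * (q * ((q - 1) * E)) := by
        rw [← Finset.add_sum_erase _ _ (Finset.mem_univ (1 : Fˣ))]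
        exact add_le_add htrans hscale
    _ = _ := by ring

end AffineTransformation

theorem stmt0 (p : ℕ) (hp : p.Prime) (F : Type*) [Field F] [Fintype F] [CharP F p]
    (q : ℕ) (hq : q = Fintype.card F) (d : ℕ) (hd : 2 ≤ d)
    (s : ℕ) (hs : s = Nat.gcd (q - 1) (d - 1)) :
    (¬ p ∣ d →
      numFunctionalGraphs F d ≤
        q ^ (d - 1) + (s - 1) * q ^ (d - 1 - Nat.totient (d - 1))) ∧
    (p ∣ d →
      numFunctionalGraphs F d ≤
        q ^ (d - 1) + (s - 1) * q ^ (d - 1 - Nat.totient (d - 1))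
          + (q - 1) * q ^ (d / p - 1)) := by
  subst hq hs
  set q := Fintype.card F with hq
  have hq1 : 1 < q := Fintype.one_lt_card
  have hpos : 0 < (q - 1) * q := Nat.mul_pos (by omega) (by omega)
  have hpow : q ^ d = q * q ^ (d - 1) := by
    rw [← pow_succ', Nat.sub_add_cancel (by omega)]
  constructor
  · intro hpd
    have h := AffineTransformation.numFunctionalGraphs_mul_card_le (F := F) (B := 0) hd
      fun g hscale hshift =>
        (AffineTransformation.card_fixedBy_eq_zero_of_translation hd hpd hscale hshift).le
    rw [← hq, hpow] at h
    refine Nat.le_of_mul_le_mul_right (h.trans_eq ?_) hpos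
    ring
  · intro hpd
    have h := AffineTransformation.numFunctionalGraphs_mul_card_le (F := F) hd
      fun g hscale hshift => AffineTransformation.card_fixedBy_le_of_translation hp.pos hd hpd
        hscale hshift
    have hdiv : 0 < d / p := Nat.div_pos (Nat.le_of_dvd (by omega) hpd) hp.pos
    have hpow' : q ^ (d / p) = q * q ^ (d / p - 1) := by
      rw [← pow_succ', Nat.sub_add_cancel hdiv]
    rw [← hq, hpow, hpow'] at h
    refine Nat.le_of_mul_le_mul_right (h.trans_eq ?_) hpos
    ring
end

section
/- For every prime power q and every integer d ≥ 3, one has N_d(q) ≤ 3·q^{d−1}. -/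
open Polynomial

/-- The affine map `x ↦ scale * x + shift` of `F`. -/
@[ext]
structure AffineMapLine (F : Type*) [Field F] where
  /-- The multiplier of the map. -/
  scale : Fˣ
  /-- The translation part of the map. -/
  shift : F

namespace AffineMapLine

variable {F : Type*} [Field F]

instance : One (AffineMapLine F) := ⟨⟨1, 0⟩⟩

instance : Mul (AffineMapLine F) :=
  ⟨fun g h => ⟨g.scale * h.scale, g.scale * h.shift + g.shift⟩⟩

instance : Inv (AffineMapLine F) :=
  ⟨fun g => ⟨g.scale⁻¹, -((g.scale⁻¹ : Fˣ) * g.shift)⟩⟩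

@[simp] lemma one_scale : (1 : AffineMapLine F).scale = 1 := rfl
@[simp] lemma one_shift : (1 : AffineMapLine F).shift = 0 := rfl
@[simp] lemma mul_scale (g h : AffineMapLine F) : (g * h).scale = g.scale * h.scale := rfl
@[simp] lemma mul_shift (g h : AffineMapLine F) :
    (g * h).shift = g.scale * h.shift + g.shift := rfl
@[simp] lemma inv_scale (g : AffineMapLine F) : g⁻¹.scale = g.scale⁻¹ := rfl
@[simp] lemma inv_shift (g : AffineMapLine F) :
    g⁻¹.shift = -((g.scale⁻¹ : Fˣ) * g.shift) := rfl

instance : Group (AffineMapLine F) :=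
  Group.ofLeftAxioms
    (fun g h k => by ext <;> simp <;> ring)
    (fun g => by ext <;> simp)
    (fun g => by ext <;> simp)

/-- An affine map is determined by its multiplier and its translation part. -/
def equivProd : AffineMapLine F ≃ Fˣ × F where
  toFun g := (g.scale, g.shift)
  invFun p := ⟨p.1, p.2⟩
  left_inv _ := rfl
  right_inv _ := rfl

noncomputable instance [Fintype F] : Fintype (AffineMapLine F) :=
  @Fintype.ofEquiv _ _ (Fintype.ofFinite _) equivProd.symm

lemma card_eq [Fintype F] :
    Fintype.card (AffineMapLine F) = (Fintype.card F - 1) * Fintype.card F := by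
  classical
  rw [Fintype.card_congr equivProd, Fintype.card_prod, Fintype.card_units]

/-- The polynomial inducing an affine map. -/
noncomputable def poly (g : AffineMapLine F) : F[X] := C (g.scale : F) * X + C g.shift

lemma poly_one : poly (1 : AffineMapLine F) = X := by simp [poly]

lemma poly_mul (g h : AffineMapLine F) : poly (g * h) = (poly g).comp (poly h) := by
  simp [poly]; ring

lemma natDegree_poly (g : AffineMapLine F) : (poly g).natDegree = 1 :=
  natDegree_linear g.scale.ne_zero

lemma poly_comp_poly_inv (g : AffineMapLine F) : (poly g).comp (poly g⁻¹) = X := by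
  rw [← poly_mul, mul_inv_cancel, poly_one]

lemma poly_inv_comp_poly (g : AffineMapLine F) : (poly g⁻¹).comp (poly g) = X := by
  rw [← poly_mul, inv_mul_cancel, poly_one]

/-- Affine maps act by conjugation on polynomials of degree `d`. -/
noncomputable instance (d : ℕ) :
    MulAction (AffineMapLine F) {f : F[X] // f.natDegree = d} where
  smul g f := ⟨(poly g).comp (f.1.comp (poly g⁻¹)), by
    simp [natDegree_comp, natDegree_poly, f.2]⟩
  one_smul f := Subtype.ext <| by
    change (poly 1).comp (f.1.comp (poly 1⁻¹)) = f.1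
    simp [poly_one]
  mul_smul g h f := Subtype.ext <| by
    change (poly (g * h)).comp (f.1.comp (poly (g * h)⁻¹)) =
      (poly g).comp (((poly h).comp (f.1.comp (poly h⁻¹))).comp (poly g⁻¹))
    simp only [mul_inv_rev, poly_mul, comp_assoc]

lemma coe_smul (d : ℕ) (g : AffineMapLine F) (f : {f : F[X] // f.natDegree = d}) :
    (g • f).1 = (poly g).comp (f.1.comp (poly g⁻¹)) := rfl

lemma smul_comp_poly (d : ℕ) (g : AffineMapLine F) (f : {f : F[X] // f.natDegree = d}) :
    (g • f).1.comp (poly g) = (poly g).comp f.1 := by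
  rw [coe_smul, comp_assoc, comp_assoc, poly_inv_comp_poly, comp_X]

/-- The bijection of `F` given by an affine map. -/
noncomputable def toEquiv (g : AffineMapLine F) : F ≃ F where
  toFun x := (poly g).eval x
  invFun x := (poly g⁻¹).eval x
  left_inv x := by
    beta_reduce
    rw [← eval_comp, poly_inv_comp_poly, eval_X]
  right_inv x := by
    beta_reduce
    rw [← eval_comp, poly_comp_poly_inv, eval_X]

lemma polyFunRel_smul (d : ℕ) (g : AffineMapLine F) (f : {f : F[X] // f.natDegree = d}) :
    polyFunRel F d f (g • f) := by
  refine ⟨toEquiv g, funext fun x => ?_⟩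
  change (poly g).eval (f.1.eval x) = (g • f).1.eval ((poly g).eval x)
  rw [← eval_comp, ← eval_comp, smul_comp_poly]

/-- A polynomial supported in two suitable degrees that is semi-invariant under a nontrivial
affine map vanishes. -/
lemma exists_pair_forall_eq_zero (g : AffineMapLine F) (hg : g ≠ 1) :
    ∃ i j : ℕ, i < j ∧ j ≤ 3 ∧ ∀ h : F[X], h.comp (poly g) = C (g.scale : F) * h →
      (∀ k, k ≠ i → k ≠ j → h.coeff k = 0) → h = 0 := by
  have key : ∀ i j : ℕ, i < j → ∀ h : F[X], (∀ k, k ≠ i → k ≠ j → h.coeff k = 0) →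
      h = C (h.coeff i) * X ^ i + C (h.coeff j) * X ^ j := by
    intro i j hij h hk
    ext k
    simp only [coeff_add, coeff_C_mul, coeff_X_pow]
    grind
  obtain ⟨a, b⟩ := g
  have ha := a.ne_zero
  simp only [poly]
  by_cases ha1 : (a : F) = 1
  · have hb : b ≠ 0 := by
      rintro rfl
      exact hg (AffineMapLine.ext (Units.ext ha1) rfl)
    rw [ha1]
    by_cases h2 : (2 : F) = 0
    · refine ⟨1, 3, by norm_num, le_rfl, fun h hh hk => ?_⟩
      have e := key 1 3 (by norm_num) h hk
      generalize h.coeff 1 = α at e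
      generalize h.coeff 3 = β at e
      subst e
      have e2 : C (3 * β * b) * X ^ 2 + C (3 * β * b ^ 2) * X + C (α * b + β * b ^ 3) = 0 := by
        simp at hh
        simp only [map_mul, map_add, map_pow, map_ofNat]
        linear_combination hh
      have c2 := congrArg (coeff · 2) e2
      have c0 := congrArg (coeff · 0) e2
      simp only [coeff_add, coeff_C_mul, coeff_X_pow, coeff_X, coeff_C, coeff_zero] at c2 c0
      have h3 : (3 : F) ≠ 0 := fun h3 => one_ne_zero (by linear_combination h3 - h2 : (1 : F) = 0)
      have hβ : β = 0 := by simpa [h3, hb] using c2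
      have hα : α = 0 := by simpa [hβ, hb] using c0
      simp [hα, hβ]
    · refine ⟨1, 2, by norm_num, by norm_num, fun h hh hk => ?_⟩
      have e := key 1 2 (by norm_num) h hk
      generalize h.coeff 1 = α at e
      generalize h.coeff 2 = β at e
      subst e
      have e2 : C (2 * β * b) * X + C (α * b + β * b ^ 2) = 0 := by
        simp at hh
        simp only [map_mul, map_add, map_pow, map_ofNat]
        linear_combination hh
      have c1 := congrArg (coeff · 1) e2
      have c0 := congrArg (coeff · 0) e2
      simp only [coeff_add, coeff_C_mul, coeff_X, coeff_C, coeff_zero] at c1 c0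
      have hβ : β = 0 := by simpa [h2, hb] using c1
      have hα : α = 0 := by simpa [hβ, hb] using c0
      simp [hα, hβ]
  · refine ⟨0, 2, by norm_num, by norm_num, fun h hh hk => ?_⟩
    have e := key 0 2 (by norm_num) h hk
    generalize h.coeff 0 = α at e
    generalize h.coeff 2 = β at e
    subst e
    have e2 : C (β * a * (a - 1)) * X ^ 2 + C (2 * β * a * b) * X +
        C (α + β * b ^ 2 - a * α) = 0 := by
      simp at hh
      simp only [map_mul, map_add, map_sub, map_pow, map_ofNat, map_one]
      linear_combination hh
    have c2 := congrArg (coeff · 2) e2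
    have c0 := congrArg (coeff · 0) e2
    simp only [coeff_add, coeff_C_mul, coeff_X_pow, coeff_X, coeff_C, coeff_zero] at c2 c0
    have hβ : β = 0 := by simpa [sub_eq_zero, ha1] using c2
    have hα : α = 0 := by
      have : (1 - (a : F)) * α = 0 := by simp [hβ] at c0; linear_combination c0
      simpa [sub_eq_zero, Ne.symm ha1] using this
    simp [hα, hβ]

lemma comp_poly_of_mem_fixedBy {d : ℕ} {g : AffineMapLine F} {f : {f : F[X] // f.natDegree = d}}
    (hf : f ∈ MulAction.fixedBy {f : F[X] // f.natDegree = d} g) :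
    f.1.comp (poly g) = C (g.scale : F) * f.1 + C g.shift := by
  have h := smul_comp_poly d g f
  rw [MulAction.mem_fixedBy.1 hf] at h
  simpa [poly] using h

lemma card_fixedBy_le [Fintype F] {d : ℕ} (hd : 3 ≤ d) (g : AffineMapLine F) (hg : g ≠ 1) :
    Nat.card (MulAction.fixedBy {f : F[X] // f.natDegree = d} g) ≤
      Fintype.card F ^ (d - 1) := by
  classical
  obtain ⟨i, j, hij, hj, H⟩ := exists_pair_forall_eq_zero g hg
  let S : Finset ℕ := ((Finset.range (d + 1)).erase i).erase j
  have hS : S.card = d - 1 := by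
    rw [Finset.card_erase_of_mem, Finset.card_erase_of_mem, Finset.card_range]
    · omega
    · simp; omega
    · simp; omega
  let φ : MulAction.fixedBy {f : F[X] // f.natDegree = d} g → (S → F) :=
    fun f k => f.1.1.coeff k
  have hφ : Function.Injective φ := by
    intro f₁ f₂ h
    refine Subtype.ext (Subtype.ext (sub_eq_zero.1 (H _ ?_ fun k hki hkj => ?_)))
    · rw [sub_comp, comp_poly_of_mem_fixedBy f₁.2, comp_poly_of_mem_fixedBy f₂.2]
      ring
    · rw [coeff_sub, sub_eq_zero]
      by_cases hk : k ≤ d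
      · exact congrFun h ⟨k, by simp [S, hki, hkj]; omega⟩
      · rw [coeff_eq_zero_of_natDegree_lt (by rw [f₁.1.2]; omega),
          coeff_eq_zero_of_natDegree_lt (by rw [f₂.1.2]; omega)]
  have := Nat.card_le_card_of_injective φ hφ
  simpa [hS] using this

end AffineMapLine

section Counting

variable {F : Type*} [Field F]

/-- The leading coefficient and the lower coefficients of a polynomial of positive degree `d`. -/
noncomputable def coeffsOfNatDegreeEq {d : ℕ} (hd : d ≠ 0) (f : {f : F[X] // f.natDegree = d}) :
    Fˣ × (Fin d → F) :=
  (Units.mk0 f.1.leadingCoeff fun h => hd <| by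
    rw [← f.2, leadingCoeff_eq_zero.1 h, natDegree_zero], fun k => f.1.coeff k)

lemma coeffsOfNatDegreeEq_injective {d : ℕ} (hd : d ≠ 0) :
    Function.Injective (coeffsOfNatDegreeEq (F := F) hd) := by
  intro f₁ f₂ h
  have hlead : f₁.1.leadingCoeff = f₂.1.leadingCoeff := congrArg (fun p => (p.1 : F)) h
  rw [leadingCoeff, leadingCoeff, f₁.2, f₂.2] at hlead
  refine Subtype.ext (ext fun k => ?_)
  rcases lt_trichotomy k d with hk | rfl | hk
  · exact congrFun (congrArg Prod.snd h) ⟨k, hk⟩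
  · exact hlead
  · rw [coeff_eq_zero_of_natDegree_lt (by rwa [f₁.2]),
      coeff_eq_zero_of_natDegree_lt (by rwa [f₂.2])]

lemma card_natDegree_eq_le [Fintype F] {d : ℕ} (hd : d ≠ 0) :
    Nat.card {f : F[X] // f.natDegree = d} ≤
      (Fintype.card F - 1) * Fintype.card F ^ d := by
  classical
  have := Nat.card_le_card_of_injective _ (coeffsOfNatDegreeEq_injective (F := F) hd)
  simpa [Fintype.card_units] using this

lemma card_orbits_le [Fintype F] {d : ℕ} (hd : 3 ≤ d) :
    Nat.card (MulAction.orbitRel.Quotient (AffineMapLine F) {f : F[X] // f.natDegree = d}) ≤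
      2 * Fintype.card F ^ (d - 1) := by
  classical
  have hd0 : d ≠ 0 := by omega
  have : Finite {f : F[X] // f.natDegree = d} :=
    Finite.of_injective _ (coeffsOfNatDegreeEq_injective hd0)
  have : Fintype {f : F[X] // f.natDegree = d} := Fintype.ofFinite _
  have : Fintype (MulAction.orbitRel.Quotient (AffineMapLine F) {f : F[X] // f.natDegree = d}) :=
    Fintype.ofFinite _
  have burnside := MulAction.sum_card_fixedBy_eq_card_orbits_mul_card_group (AffineMapLine F)
    {f : F[X] // f.natDegree = d}
  have hfix : ∀ g ∈ (Finset.univ : Finset (AffineMapLine F)).erase 1,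
      Fintype.card (MulAction.fixedBy {f : F[X] // f.natDegree = d} g) ≤
        Fintype.card F ^ (d - 1) := fun g hg => by
    rw [← Nat.card_eq_fintype_card]
    exact AffineMapLine.card_fixedBy_le hd g (Finset.ne_of_mem_erase hg)
  have hone : Fintype.card (MulAction.fixedBy {f : F[X] // f.natDegree = d}
      (1 : AffineMapLine F)) ≤ (Fintype.card F - 1) * Fintype.card F ^ d :=
    (Fintype.card_subtype_le _).trans
      (Nat.card_eq_fintype_card (α := {f : F[X] // f.natDegree = d}) ▸ card_natDegree_eq_le hd0)
  rw [← Finset.add_sum_erase _ _ (Finset.mem_univ 1)] at burnside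
  have hsum := Finset.sum_le_card_nsmul _ _ _ hfix
  rw [smul_eq_mul] at hsum
  have hcard : ((Finset.univ : Finset (AffineMapLine F)).erase 1).card ≤
      (Fintype.card F - 1) * Fintype.card F :=
    (Finset.card_erase_le).trans_eq (by rw [Finset.card_univ, AffineMapLine.card_eq])
  have hsum' := hsum.trans (Nat.mul_le_mul_right _ hcard)
  have hpos : 0 < (Fintype.card F - 1) * Fintype.card F := by
    rw [← AffineMapLine.card_eq]; exact Fintype.card_pos
  have hpow : Fintype.card F ^ d = Fintype.card F * Fintype.card F ^ (d - 1) := by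
    rw [← pow_succ', Nat.sub_add_cancel (by omega)]
  rw [hpow] at hone
  rw [AffineMapLine.card_eq] at burnside
  rw [Nat.card_eq_fintype_card]
  refine Nat.le_of_mul_le_mul_right (burnside.symm.le.trans ((add_le_add hone hsum').trans ?_)) hpos
  exact le_of_eq (by ring)

end Counting

theorem stmt2 (F : Type*) [Field F] [Fintype F] (q : ℕ) (hq : q = Fintype.card F)
    (d : ℕ) (hd : 3 ≤ d) :
    numFunctionalGraphs F d ≤ 3 * q ^ (d - 1) := by
  subst hq
  have : Finite {f : F[X] // f.natDegree = d} :=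
    Finite.of_injective _ (coeffsOfNatDegreeEq_injective (by omega))
  let ψ : MulAction.orbitRel.Quotient (AffineMapLine F) {f : F[X] // f.natDegree = d} →
      Quot (polyFunRel F d) :=
    Quotient.lift (Quot.mk _) <| by
      rintro _ f ⟨g, rfl⟩
      exact (Quot.sound (AffineMapLine.polyFunRel_smul d g f)).symm
  have hψ : Function.Surjective ψ := fun y =>
    Quot.inductionOn y fun f => ⟨Quotient.mk _ f, rfl⟩
  calc numFunctionalGraphs F d
      ≤ Nat.card (MulAction.orbitRel.Quotient (AffineMapLine F)
          {f : F[X] // f.natDegree = d}) := Nat.card_le_card_of_surjective ψ hψ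
    _ ≤ 2 * Fintype.card F ^ (d - 1) := card_orbits_le hd
    _ ≤ 3 * Fintype.card F ^ (d - 1) := Nat.mul_le_mul_right _ (by norm_num)
end

section
/- Fix an integer d ≥ 2 and a real ε > 0. Then there exists Q such that for every prime power q > Q with gcd(d−1, q) = 1 and e := gcd(d, q−1) ≥ 2, one has N_d(q) ≥ q^{ρ_{d,e} − ε}, where ρ_{d,e} = 1 / (2·(e − 1 + log d / log e)). -/
open Polynomial

theorem irreducible_X_pow_sub_C_of_pow_ne {K : Type*} [Field K] {m : ℕ} (hm : 0 < m) (a : K)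
    (h : ∀ s, 0 < s → s < m → ∀ κ : K, κ ^ m ≠ a ^ s) : Irreducible (X ^ m - C a) := by
  have hmon : (X ^ m - C a).Monic := monic_X_pow_sub_C a hm.ne'
  have hdeg : (X ^ m - C a).natDegree = m := natDegree_X_pow_sub_C
  rw [hmon.irreducible_iff_natDegree]
  refine ⟨fun h1 => by rw [h1, natDegree_one] at hdeg; omega, fun f g hf hg hfg => ?_⟩
  by_contra! hne
  have hsum : f.natDegree + g.natDegree = m := by
    rw [← hdeg, ← hfg, hf.natDegree_mul hg]
  set φ := algebraMap K (AlgebraicClosure K)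
  have hsp : (f.map φ).Splits := IsAlgClosed.splits _
  have h0 := hsp.coeff_zero_eq_prod_roots_of_monic (hf.map φ)
  have hroots : ∀ x ∈ (f.map φ).roots, x ^ m = φ a := by
    intro x hx
    have hx0 : (f.map φ).eval x = 0 := (mem_roots'.1 hx).2
    have : ((X ^ m - C a).map φ).eval x = 0 := by
      rw [← hfg, Polynomial.map_mul, eval_mul, hx0, zero_mul]
    simpa [sub_eq_zero] using this
  have hcard : (f.map φ).roots.card = f.natDegree := by
    rw [← hsp.natDegree_eq_card_roots, natDegree_map]
  refine h f.natDegree (by omega) (by omega) ((-1) ^ f.natDegree * f.coeff 0) ?_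
  apply φ.injective
  have h2 : φ ((-1) ^ f.natDegree * f.coeff 0) = (f.map φ).roots.prod := by
    rw [coeff_map, natDegree_map] at h0
    rw [map_mul, h0, ← mul_assoc, map_pow, map_neg, map_one, ← mul_pow]
    simp
  have h3 := Multiset.prod_map_pow (m := (f.map φ).roots) (f := id) (n := m)
  simp only [id_eq, Multiset.map_id'] at h3
  rw [map_pow, map_pow, h2, ← h3, ← hcard, Multiset.map_congr rfl hroots,
    Multiset.map_const', Multiset.prod_replicate]

theorem natDegree_det_le_mul {R : Type*} [CommRing R] {n : ℕ} (M : Matrix (Fin n) (Fin n) R[X])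
    (N : ℕ) (h : ∀ i j, (M i j).natDegree ≤ N) : M.det.natDegree ≤ n * N := by
  rw [Matrix.det_apply]
  refine natDegree_sum_le_of_forall_le _ _ fun σ _ => ?_
  refine (natDegree_smul_le _ _).trans ((natDegree_prod_le _ _).trans ?_)
  refine (Finset.sum_le_card_nsmul _ _ N fun i _ => h _ _).trans ?_
  simp

theorem sum_mul_sum_eq_cyclic {L : Type*} [CommRing L] {m : ℕ} [NeZero m] (p c y : L)
    (hy : p * y ^ m = c) (r v : Fin m → L) :
    p * ((∑ j, r j * y ^ (j : ℕ)) * ∑ l, v l * y ^ (l : ℕ)) =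
      ∑ i : Fin m, y ^ (i : ℕ) * ∑ l, ((if l ≤ i then p else c) * r (i - l)) * v l := by
  have key : ∀ l j : Fin m, p * (r j * y ^ (j : ℕ) * (v l * y ^ (l : ℕ))) =
      y ^ ((j + l : Fin m) : ℕ) *
        (((if l ≤ j + l then p else c) * r (j + l - l)) * v l) := by
    intro l j
    simp only [add_sub_cancel_right, Fin.le_def, Fin.val_add]
    have hj := j.2
    have hl := l.2
    by_cases hlt : (j : ℕ) + l < m
    · rw [Nat.mod_eq_of_lt hlt, if_pos (by omega)]
      ring
    · have h1 : ((j : ℕ) + l) % m = j + l - m := by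
        rw [Nat.mod_eq_sub_mod (by omega), Nat.mod_eq_of_lt (by omega)]
      rw [h1, if_neg (by omega), ← hy]
      have h2 : y ^ (j : ℕ) * y ^ (l : ℕ) = y ^ ((j : ℕ) + l - m) * y ^ m := by
        rw [← pow_add, ← pow_add]; congr 1; omega
      linear_combination (p * r j * v l) * h2
  simp_rw [Finset.mul_sum]
  rw [Finset.sum_comm (s := Finset.univ) (t := Finset.univ)
    (f := fun i l : Fin m => y ^ (i : ℕ) * (((if l ≤ i then p else c) * r (i - l)) * v l))]
  refine Finset.sum_congr rfl fun l _ => ?_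
  rw [Finset.sum_mul, Finset.mul_sum,
    ← Equiv.sum_comp (Equiv.addRight l) (fun i : Fin m => y ^ (i : ℕ) * _)]
  exact Finset.sum_congr rfl fun j _ => key l j

theorem eq_zero_or_eq_zero_of_cyclic_mulVec {R : Type*} [CommRing R] [IsDomain R]
    {m : ℕ} [NeZero m] (p c : R) (hp : p ≠ 0)
    (hirr : Irreducible (X ^ m - C (algebraMap R (FractionRing R) c / algebraMap R _ p)))
    (r v : Fin m → R)
    (h : ∀ i, ∑ l, ((if l ≤ i then p else c) * r (i - l)) * v l = 0) : r = 0 ∨ v = 0 := by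
  set K := FractionRing R
  set f : K[X] := X ^ m - C (algebraMap R K c / algebraMap R K p)
  have : Fact (Irreducible f) := ⟨hirr⟩
  set φ : R →+* AdjoinRoot f := (AdjoinRoot.of f).comp (algebraMap R K)
  have hφ : Function.Injective φ :=
    (AdjoinRoot.of f).injective.comp (IsFractionRing.injective R K)
  have hpK : algebraMap R K p ≠ 0 := by
    simpa using hp
  set y := AdjoinRoot.root f
  have hy : φ p * y ^ m = φ c := by
    have h1 : AdjoinRoot.mk f f = 0 := AdjoinRoot.mk_self
    have h2 : y ^ m = AdjoinRoot.of f (algebraMap R K c / algebraMap R K p) := by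
      rw [← sub_eq_zero, ← h1, show y = AdjoinRoot.mk f X from AdjoinRoot.mk_X.symm,
        ← AdjoinRoot.mk_C, ← map_pow, ← map_sub]
    rw [h2, RingHom.comp_apply, RingHom.comp_apply, ← map_mul, mul_div_cancel₀ _ hpK]
  have hind : ∀ r : Fin m → R, ∑ j, φ (r j) * y ^ (j : ℕ) = 0 → r = 0 := by
    intro r hr
    set g : K[X] := ∑ j : Fin m, C (algebraMap R K (r j)) * X ^ (j : ℕ) with hg
    have h1 : AdjoinRoot.mk f g = 0 := by
      rw [← hr, hg, map_sum]
      simp [φ, y]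
    have h2 : f ∣ g := AdjoinRoot.mk_eq_zero.1 h1
    have hdeg : g.degree < f.degree := by
      rw [degree_X_pow_sub_C (NeZero.pos m)]
      refine (degree_sum_le _ _).trans_lt ?_
      refine (Finset.sup_lt_iff (WithBot.bot_lt_coe m)).2 fun j _ => ?_
      refine (degree_C_mul_X_pow_le _ _).trans_lt ?_
      exact Nat.cast_lt.2 j.2
    have h3 : g = 0 := eq_zero_of_dvd_of_degree_lt h2 hdeg
    funext j
    have h4 : g.coeff j = algebraMap R K (r j) := by
      rw [hg, finsetSum_coeff, Finset.sum_eq_single j]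
      · simp
      · intro b _ hb
        rw [coeff_C_mul, coeff_X_pow, if_neg, mul_zero]
        exact fun h => hb (Fin.ext h.symm)
      · simp
    rw [h3, coeff_zero] at h4
    exact IsFractionRing.injective R K (by simpa using h4.symm)
  have hprod := sum_mul_sum_eq_cyclic (φ p) (φ c) y hy (fun j => φ (r j)) (fun j => φ (v j))
  have h0 : ∑ i : Fin m, y ^ (i : ℕ) *
      ∑ l, ((if l ≤ i then φ p else φ c) * φ (r (i - l))) * φ (v l) = 0 := by
    refine Finset.sum_eq_zero fun i _ => ?_
    have := congrArg φ (h i)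
    rw [map_sum, map_zero] at this
    simp only [map_mul, apply_ite φ] at this
    rw [this, mul_zero]
  rw [h0] at hprod
  have hφp : φ p ≠ 0 := by
    rw [Ne, map_eq_zero_iff φ hφ]; exact hp
  rcases mul_eq_zero.1 ((mul_eq_zero.1 hprod).resolve_left hφp) with h | h
  · exact Or.inl (hind _ h)
  · exact Or.inr (hind _ h)

theorem irreducible_X_pow_sub_C_div {F : Type*} [Field F] {m : ℕ} (hm : 0 < m)
    (P : F[X]) (hP : P ≠ 0) (c : F) (hc : c ≠ 0)
    (hirr : ∀ s, 0 < s → s < m → ∃ α : AlgebraicClosure F,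
      ¬ m ∣ s * (P.map (algebraMap F (AlgebraicClosure F))).rootMultiplicity α) :
    Irreducible (X ^ m - C (algebraMap F[X] (FractionRing F[X]) (C c) /
      algebraMap F[X] (FractionRing F[X]) P)) := by
  classical
  apply irreducible_X_pow_sub_C_of_pow_ne hm
  intro s hs hsm κ hκ
  obtain ⟨α, hα⟩ := hirr s hs hsm
  obtain ⟨a, b, hb, rfl⟩ := IsFractionRing.div_surjective (A := F[X]) κ
  have hb0 : b ≠ 0 := nonZeroDivisors.ne_zero hb
  have hbK : algebraMap F[X] (FractionRing F[X]) b ≠ 0 := by simpa using hb0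
  have hPK : algebraMap F[X] (FractionRing F[X]) P ≠ 0 := by simpa using hP
  have heq : a ^ m * P ^ s = C c ^ s * b ^ m := by
    apply IsFractionRing.injective F[X] (FractionRing F[X])
    rw [div_pow, div_pow, div_eq_div_iff (pow_ne_zero _ hbK) (pow_ne_zero _ hPK)] at hκ
    simpa using hκ
  have hne : C c ^ s * b ^ m ≠ 0 :=
    mul_ne_zero (pow_ne_zero _ (by simpa using hc)) (pow_ne_zero _ hb0)
  set φ := algebraMap F (AlgebraicClosure F)
  have hne' : (C c ^ s * b ^ m).map φ ≠ 0 := by simpa using hne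
  have h1 := congrArg (fun p : F[X] => (p.map φ).rootMultiplicity α) heq
  have hne'' := heq ▸ hne'
  simp only [Polynomial.map_mul, Polynomial.map_pow, map_C] at h1 hne' hne''
  rw [rootMultiplicity_mul hne', rootMultiplicity_mul hne''] at h1
  rw [← C_pow, rootMultiplicity_C, zero_add] at h1
  rw [← count_roots, ← count_roots, ← count_roots] at h1
  rw [← count_roots] at hα
  rw [roots_pow, roots_pow, roots_pow, Multiset.count_nsmul, Multiset.count_nsmul,
    Multiset.count_nsmul] at h1
  apply hα
  have h2 : m ∣ m * Multiset.count α (map φ a).roots +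
      s * Multiset.count α (map φ P).roots := h1 ▸ dvd_mul_right _ _
  exact (Nat.dvd_add_right (dvd_mul_right _ _)).1 h2

theorem eq_zero_of_dvd_sum_mul_pow {F : Type*} [Field F] [Fintype F] {q m A D : ℕ}
    (hq : Fintype.card F = q) (hm : 0 < m) (hmq : m ∣ q - 1) (P : F[X]) (hPD : P.natDegree ≤ D)
    (hirr : ∀ s, 0 < s → s < m → ∃ α : AlgebraicClosure F,
      ¬ m ∣ s * (P.map (algebraMap F (AlgebraicClosure F))).rootMultiplicity α)
    (β : F) (hβ : P.eval β ≠ 0) (hA : m * (A + D) < q)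
    (r : Fin m → F[X]) (hr : ∀ j, (r j).natDegree ≤ A)
    (hdvd : X ^ q - C β ∣ ∑ j, r j * (P ^ ((q - 1) / m)) ^ (j : ℕ)) : r = 0 := by
  have : NeZero m := ⟨hm.ne'⟩
  have hP : P ≠ 0 := by rintro rfl; simp at hβ
  have hq0 : 0 < q := by omega
  set W : F[X] := X ^ q - C β
  set Z : F[X] := P ^ ((q - 1) / m)
  set c := P.eval β
  have hPZ : P * Z ^ m = P ^ q := by
    rw [← pow_mul, Nat.div_mul_cancel hmq, ← pow_succ']
    congr 1; omega
  have hWc : W ∣ P ^ q - C c := by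
    have h1 : P ^ q = P.comp (X ^ q) := by
      rw [← hq, ← FiniteField.expand_card, expand_eq_comp_X_pow]
    have h2 : C c = P.comp (C β) := by simp [c]
    rw [h1, h2]
    exact sub_dvd_eval_sub (X ^ q) (C β) (P.map C) |>.trans (by simp [eval_map, comp])
  set B : Matrix (Fin m) (Fin m) F[X] :=
    Matrix.of fun i l => (if l ≤ i then P else C c) * r (i - l) with hB
  have hdet : W ∣ B.det := by
    have hmod : ∀ l, W ∣ ∑ i : Fin m, Z ^ (i : ℕ) * B i l := by
      intro l
      set φ := Ideal.Quotient.mk (Ideal.span {W})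
      have hk : ∀ {a : F[X]}, φ a = 0 ↔ a ∈ Ideal.span {W} := Ideal.Quotient.eq_zero_iff_mem
      have hy : φ P * φ Z ^ m = φ (C c) := by
        rw [← map_pow, ← map_mul, hPZ, ← sub_eq_zero, ← map_sub]
        exact hk.2 (Ideal.mem_span_singleton.2 hWc)
      have h1 := sum_mul_sum_eq_cyclic (φ P) (φ (C c)) (φ Z) hy (fun j => φ (r j))
        (Pi.single l 1)
      have h2 : ∑ j, φ (r j) * φ Z ^ (j : ℕ) = 0 := by
        rw [← hk.2 (Ideal.mem_span_singleton.2 hdvd)]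
        simp
      rw [h2, zero_mul, mul_zero] at h1
      rw [← Ideal.mem_span_singleton, ← hk]
      simp only [map_sum, map_mul, map_pow, hB, Matrix.of_apply, apply_ite φ]
      simpa [Pi.single_apply] using h1.symm
    have h1 : Matrix.vecMul (Matrix.vecMul (fun i : Fin m => Z ^ (i : ℕ)) B) B.adjugate 0 =
        B.det := by
      rw [Matrix.vecMul_vecMul, Matrix.mul_adjugate, Matrix.vecMul_smul]
      simp
    rw [← h1]
    rw [Matrix.vecMul, dotProduct]
    refine Finset.dvd_sum fun i _ => Dvd.dvd.mul_right (hmod i) _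
  have hdet0 : B.det = 0 := by
    refine eq_zero_of_dvd_of_natDegree_lt hdet ?_
    rw [natDegree_X_pow_sub_C]
    refine (natDegree_det_le_mul B (A + D) fun i j => ?_).trans_lt hA
    rw [hB, Matrix.of_apply]
    refine natDegree_mul_le.trans ?_
    rw [add_comm]
    refine add_le_add (hr _) ?_
    split_ifs
    · exact hPD
    · simp
  obtain ⟨v, hv, hBv⟩ := Matrix.exists_mulVec_eq_zero_iff.2 hdet0
  refine (eq_zero_or_eq_zero_of_cyclic_mulVec P (C c) hP
    (irreducible_X_pow_sub_C_div hm P hP c hβ hirr) r v fun i => ?_).resolve_right hv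
  exact congrFun hBv i

theorem pow_sub_dvd_hasseDeriv_pow {R : Type*} [CommRing R] (P : R[X]) (N i : ℕ) :
    P ^ (N - i) ∣ hasseDeriv i (P ^ N) := by
  induction N generalizing i with
  | zero => simp
  | succ N ih =>
    rw [pow_succ', hasseDeriv_mul]
    refine Finset.dvd_sum fun ab hab => ?_
    rw [Finset.HasAntidiagonal.mem_antidiagonal] at hab
    rcases Nat.eq_zero_or_pos ab.1 with h0 | h0
    · rw [h0, hasseDeriv_zero']
      refine (pow_dvd_pow P (show N + 1 - i ≤ (N - ab.2) + 1 by omega)).trans ?_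
      rw [pow_succ']
      exact mul_dvd_mul_left P (ih _)
    · exact ((pow_dvd_pow P (by omega)).trans (ih ab.2)).mul_left _

theorem exists_hasseDeriv_pow_eq {F : Type*} [Field F] (P : F[X]) (hP : P ≠ 0) {D : ℕ}
    (hPD : P.natDegree ≤ D) (N i : ℕ) (hi : i ≤ N) :
    ∃ g : F[X], hasseDeriv i (P ^ N) = P ^ (N - i) * g ∧ g.natDegree ≤ i * D := by
  obtain ⟨g, hg⟩ := pow_sub_dvd_hasseDeriv_pow P N i
  refine ⟨g, hg, ?_⟩
  rcases eq_or_ne g 0 with rfl | hg0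
  · simp
  have h1 : (hasseDeriv i (P ^ N)).natDegree ≤ N * P.natDegree := by
    refine (natDegree_hasseDeriv_le _ _).trans ?_
    rw [natDegree_pow]; omega
  rw [hg, natDegree_mul (pow_ne_zero _ hP) hg0, natDegree_pow] at h1
  obtain ⟨k, rfl⟩ := Nat.exists_eq_add_of_le hi
  rw [Nat.add_sub_cancel_left, add_mul] at h1
  exact (by omega : g.natDegree ≤ i * P.natDegree).trans (Nat.mul_le_mul_left i hPD)

/-- A linear version of dividing the `i`-th Hasse derivative of `P ^ N * r` by `P ^ (N - i)`. -/
theorem exists_linearMap_hasseDeriv_pow_mul {F : Type*} [Field F] (P : F[X]) (hP : P ≠ 0)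
    {D : ℕ} (hPD : P.natDegree ≤ D) (N i : ℕ) (hi : i ≤ N) :
    ∃ T : F[X] →ₗ[F] F[X], ∀ r, hasseDeriv i (P ^ N * r) = P ^ (N - i) * T r ∧
      (T r).natDegree ≤ r.natDegree + i * D := by
  have h : ∀ a : ℕ, ∃ g : F[X], a ≤ N → hasseDeriv a (P ^ N) = P ^ (N - a) * g ∧
      g.natDegree ≤ a * D := fun a => by
    by_cases ha : a ≤ N
    · obtain ⟨g, hg⟩ := exists_hasseDeriv_pow_eq P hP hPD N a ha
      exact ⟨g, fun _ => hg⟩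
    · exact ⟨0, fun h => absurd h ha⟩
  choose g hg using h
  refine ⟨∑ ab ∈ Finset.HasAntidiagonal.antidiagonal i,
    (LinearMap.mulLeft F (g ab.1 * P ^ ab.2)) ∘ₗ hasseDeriv ab.2, fun r => ⟨?_, ?_⟩⟩
  · rw [hasseDeriv_mul, LinearMap.sum_apply, Finset.mul_sum]
    refine Finset.sum_congr rfl fun ab hab => ?_
    rw [Finset.HasAntidiagonal.mem_antidiagonal] at hab
    rw [(hg ab.1 (by omega)).1, LinearMap.comp_apply, LinearMap.mulLeft_apply,
      show N - ab.1 = N - i + ab.2 by omega, pow_add]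
    ring
  · rw [LinearMap.sum_apply]
    refine natDegree_sum_le_of_forall_le _ _ fun ab hab => ?_
    rw [Finset.HasAntidiagonal.mem_antidiagonal] at hab
    rw [LinearMap.comp_apply, LinearMap.mulLeft_apply]
    have h1 := (hg ab.1 (by omega)).2
    have h2 : (P ^ ab.2).natDegree ≤ ab.2 * D :=
      natDegree_pow_le.trans (Nat.mul_le_mul_left _ hPD)
    have h3 := natDegree_hasseDeriv_le r ab.2
    have h4 : i * D = ab.1 * D + ab.2 * D := by rw [← hab, add_mul]
    refine natDegree_mul_le.trans ?_
    have h5 := natDegree_mul_le (p := g ab.1) (q := P ^ ab.2)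
    omega

theorem X_sub_C_pow_dvd_of_taylor_coeff {R : Type*} [CommRing R] (f : R[X]) (x : R) (l : ℕ)
    (h : ∀ i < l, (taylor x f).coeff i = 0) : (X - C x) ^ l ∣ f := by
  rw [X_sub_C_pow_dvd_iff, ← taylor_apply, X_pow_dvd_iff]
  exact h

theorem card_mul_le_natDegree_of_pow_dvd {F : Type*} [Field F] (f : F[X]) (hf : f ≠ 0)
    (S : Finset F) (l : ℕ) (h : ∀ x ∈ S, (X - C x) ^ l ∣ f) : S.card * l ≤ f.natDegree := by
  have h1 : ∏ x ∈ S, (X - C x) ^ l ∣ f := by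
    refine Finset.prod_dvd_of_coprime (fun x _ y _ hxy => ?_) h
    exact (pairwise_coprime_X_sub_C Function.injective_id hxy).pow
  refine le_trans (le_of_eq ?_) (natDegree_le_of_dvd h1 hf)
  rw [natDegree_prod _ _ fun x _ => pow_ne_zero _ (X_sub_C_ne_zero x)]
  simp

theorem exists_stepanov_coefficients {F : Type*} [Field F] {m K A l D : ℕ}
    (P : F[X]) (hP : P ≠ 0) (hPD : P.natDegree ≤ D) (e : ℕ) (w β : F)
    (hcount : l * (A + 1 + l * D + K) < m * K * (A + 1)) :
    ∃ r : Fin m × Fin K → F[X], r ≠ 0 ∧ (∀ jk, (r jk).natDegree ≤ A) ∧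
      ∀ i < l, ∀ x : F, P.eval x ^ e = w →
        ∑ jk : Fin m × Fin K, (x - β) ^ (jk.2 : ℕ) *
          (hasseDeriv i (P ^ (l + e * (jk.1 : ℕ)) * r jk)).eval x = 0 := by
  have hT : ∀ (i : Fin l) (j : Fin m), ∃ T : F[X] →ₗ[F] F[X], ∀ r,
      hasseDeriv (i : ℕ) (P ^ (l + e * (j : ℕ)) * r) = P ^ (l + e * (j : ℕ) - i) * T r ∧
      (T r).natDegree ≤ r.natDegree + i * D := fun i j =>
    exists_linearMap_hasseDeriv_pow_mul P hP hPD _ _ (by omega)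
  choose T hT using hT
  set V := Fin m × Fin K → degreeLT F (A + 1)
  set L := A + 1 + l * D + K
  have hsmall : ∀ r : degreeLT F (A + 1), (r : F[X]).natDegree ≤ A := by
    intro r
    have h1 : (r : F[X]) ∈ degreeLE F A := degreeLT_succ_eq_degreeLE (R := F) ▸ r.2
    exact natDegree_le_of_degree_le (mem_degreeLE.1 h1)
  set Ψ : V →ₗ[F] (Fin l → F[X]) := LinearMap.pi fun i =>
    ∑ jk : Fin m × Fin K, (LinearMap.mulLeft F (C (w ^ (jk.1 : ℕ)) * (X - C β) ^ (jk.2 : ℕ))) ∘ₗ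
      (T i jk.1) ∘ₗ (degreeLT F (A + 1)).subtype ∘ₗ LinearMap.proj jk with hΨ
  have hΨa : ∀ v i, Ψ v i = ∑ jk : Fin m × Fin K,
      C (w ^ (jk.1 : ℕ)) * (X - C β) ^ (jk.2 : ℕ) * T i jk.1 (v jk) := by
    intro v i
    simp only [hΨ, LinearMap.pi_apply, LinearMap.sum_apply]
    rfl
  have hdeg : ∀ v i, (Ψ v i).natDegree < L := by
    intro v i
    have hL : 0 < L := by omega
    rw [hΨa]
    refine Nat.lt_of_le_pred hL ?_
    rw [Nat.pred_eq_sub_one, show L = A + 1 + l * D + K from rfl]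
    refine natDegree_sum_le_of_forall_le _ _ fun jk _ => ?_
    have h1 : (C (w ^ (jk.1 : ℕ)) * (X - C β) ^ (jk.2 : ℕ)).natDegree ≤ (jk.2 : ℕ) := by
      refine (natDegree_C_mul_le _ _).trans ?_
      rw [natDegree_pow, natDegree_X_sub_C, mul_one]
    have h2 := (hT i jk.1 (v jk)).2
    have h3 := hsmall (v jk)
    have h4 : (i : ℕ) * D ≤ l * D := Nat.mul_le_mul_right _ i.2.le
    have h5 := jk.2.2
    refine natDegree_mul_le.trans ?_
    omega
  set Φ : V →ₗ[F] (Fin l × Fin L → F) := LinearMap.pi fun ib =>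
    lcoeff F (ib.2 : ℕ) ∘ₗ LinearMap.proj ib.1 ∘ₗ Ψ with hΦ
  have hker : LinearMap.ker Φ ≠ ⊥ := by
    apply LinearMap.ker_ne_bot_of_finrank_lt
    rw [Module.finrank_fintype_fun_eq_card]
    have : Module.finrank F V = m * K * (A + 1) := by
      rw [((LinearEquiv.piCongrRight fun _ : Fin m × Fin K =>
        degreeLTEquiv F (A + 1))).finrank_eq]
      rw [Module.finrank_pi_fintype]
      simp
    rw [this]
    simpa [Fintype.card_prod] using hcount
  obtain ⟨v, hv, hv0⟩ := (Submodule.ne_bot_iff _).1 hker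
  have hΨ0 : ∀ i, Ψ v i = 0 := by
    intro i
    ext b
    rw [coeff_zero]
    by_cases hb : b < L
    · exact congrFun (LinearMap.mem_ker.1 hv) (i, ⟨b, hb⟩)
    · exact coeff_eq_zero_of_natDegree_lt ((hdeg v i).trans_le (not_lt.1 hb))
  refine ⟨fun jk => v jk, fun h0 => hv0 ?_, fun jk => hsmall _, fun i hi x hx => ?_⟩
  · funext jk
    exact Subtype.ext (congrFun h0 jk)
  · have h1 := congrArg (eval x) (hΨ0 ⟨i, hi⟩)
    rw [hΨa, eval_finsetSum, eval_zero] at h1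
    have h2 := congrArg (fun z => P.eval x ^ (l - i) * z) h1
    simp only [mul_zero, Finset.mul_sum] at h2
    rw [← h2]
    refine Finset.sum_congr rfl fun jk _ => ?_
    have h3 := (hT ⟨i, hi⟩ jk.1 (v jk)).1
    simp only at h3
    rw [h3]
    simp only [eval_mul, eval_pow, eval_sub, eval_X, eval_C]
    rw [show l + e * (jk.1 : ℕ) - i = (l - i) + e * jk.1 by omega, pow_add, pow_mul, hx]
    ring

theorem coeff_mul_X_pow_add_C_pow {R : Type*} [CommRing R] (f : R[X]) (q k i : ℕ) (c : R)
    (hi : i < q) : (f * (X ^ q + C c) ^ k).coeff i = c ^ k * f.coeff i := by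
  obtain ⟨h, hh⟩ := sub_dvd_pow_sub_pow (X ^ q + C c) (C c : R[X]) k
  have h1 : f * (X ^ q + C c) ^ k = C (c ^ k) * f + X ^ q * (h * f) := by
    rw [add_sub_cancel_right] at hh
    rw [C_pow]
    linear_combination f * hh
  rw [h1, coeff_add, coeff_C_mul, coeff_X_pow_mul', if_neg (by omega), add_zero]

theorem stepanov_sum_ne_zero {F : Type*} [Field F] [Fintype F] {q m A D K : ℕ} (l : ℕ)
    (hq : Fintype.card F = q) (hm : 0 < m) (hmq : m ∣ q - 1) (P : F[X]) (hPD : P.natDegree ≤ D)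
    (hirr : ∀ s, 0 < s → s < m → ∃ α : AlgebraicClosure F,
      ¬ m ∣ s * (P.map (algebraMap F (AlgebraicClosure F))).rootMultiplicity α)
    (β : F) (hβ : P.eval β ≠ 0) (hA : m * (A + D) < q)
    (r : Fin m × Fin K → F[X]) (hr : ∀ jk, (r jk).natDegree ≤ A) (hr0 : r ≠ 0) :
    ∑ jk : Fin m × Fin K, P ^ (l + (q - 1) / m * (jk.1 : ℕ)) * r jk *
      (X ^ q - C β) ^ (jk.2 : ℕ) ≠ 0 := by
  classical
  have hP : P ≠ 0 := by rintro rfl; simp at hβ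
  have hW : X ^ q - C β ≠ 0 := (monic_X_pow_sub_C β (by omega)).ne_zero
  set W : F[X] := X ^ q - C β
  set Z : F[X] := P ^ ((q - 1) / m)
  set G : Fin K → F[X] := fun k => ∑ j, r (j, k) * Z ^ (j : ℕ) with hG
  intro h0
  have h1 : P ^ l * ∑ k : Fin K, W ^ (k : ℕ) * G k = 0 := by
    rw [← h0, Fintype.sum_prod_type_right, Finset.mul_sum]
    refine Finset.sum_congr rfl fun k _ => ?_
    rw [hG]
    simp only [Finset.mul_sum]
    refine Finset.sum_congr rfl fun j _ => ?_
    rw [pow_add, pow_mul]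
    ring
  have h2 := (mul_eq_zero.1 h1).resolve_left (pow_ne_zero _ hP)
  have h3 : ∀ n (hn : n < K), ∀ j, r (j, ⟨n, hn⟩) = 0 := by
    intro n
    induction n using Nat.strong_induction_on with
    | _ n ih =>
      intro hn
      have hsum : W ^ n * G ⟨n, hn⟩ + ∑ k ∈ Finset.univ.erase (⟨n, hn⟩ : Fin K),
          W ^ (k : ℕ) * G k = 0 := by
        rw [← h2, ← Finset.add_sum_erase _ _ (Finset.mem_univ (⟨n, hn⟩ : Fin K))]
      have hdiv : W ^ (n + 1) ∣ ∑ k ∈ Finset.univ.erase (⟨n, hn⟩ : Fin K),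
          W ^ (k : ℕ) * G k := by
        refine Finset.dvd_sum fun k hk => ?_
        have hkn : (k : ℕ) ≠ n := fun h => (Finset.mem_erase.1 hk).1 (Fin.ext h)
        rcases lt_or_gt_of_ne hkn with h | h
        · have : G k = 0 := Finset.sum_eq_zero fun j _ => by rw [ih k h k.2 j, zero_mul]
          rw [this, mul_zero]
          exact dvd_zero _
        · exact (pow_dvd_pow W h).mul_right _
      have hdvd : W ∣ G ⟨n, hn⟩ := by
        have : W ^ (n + 1) ∣ W ^ n * G ⟨n, hn⟩ := by
          rw [eq_neg_of_add_eq_zero_left hsum]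
          exact (dvd_neg).2 hdiv
        rw [pow_succ] at this
        exact (mul_dvd_mul_iff_left (pow_ne_zero _ hW)).1 this
      exact congrFun (eq_zero_of_dvd_sum_mul_pow hq hm hmq P hPD hirr β hβ hA
        (fun j => r (j, ⟨n, hn⟩)) (fun j => hr _) hdvd)
  exact hr0 (funext fun jk => h3 jk.2 jk.2.2 jk.1)

theorem card_mul_le_of_stepanov {F : Type*} [Field F] [Fintype F] [DecidableEq F]
    {q m A D K l : ℕ}
    (hq : Fintype.card F = q) (hm : 0 < m) (hmq : m ∣ q - 1) (P : F[X]) (hPD : P.natDegree ≤ D)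
    (hirr : ∀ s, 0 < s → s < m → ∃ α : AlgebraicClosure F,
      ¬ m ∣ s * (P.map (algebraMap F (AlgebraicClosure F))).rootMultiplicity α)
    (β : F) (hβ : P.eval β ≠ 0) (hA : m * (A + D) < q) (hl : l ≤ q)
    (hcount : l * (A + 1 + l * D + K) < m * K * (A + 1)) (w : F) :
    (Finset.univ.filter fun x : F => P.eval x ^ ((q - 1) / m) = w).card * l ≤
      l * D + D * q + K * q := by
  have hP : P ≠ 0 := by rintro rfl; simp at hβ
  obtain ⟨r, hr0, hr, hvan⟩ :=
    exists_stepanov_coefficients (m := m) P hP hPD ((q - 1) / m) w β hcount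
  have hR0 := stepanov_sum_ne_zero l hq hm hmq P hPD hirr β hβ hA r hr hr0
  refine (card_mul_le_natDegree_of_pow_dvd _ hR0 _ l fun x hx => ?_).trans ?_
  · rw [Finset.mem_filter] at hx
    refine X_sub_C_pow_dvd_of_taylor_coeff _ _ _ fun i hi => ?_
    rw [map_sum, finsetSum_coeff, ← hvan i hi x hx.2]
    refine Finset.sum_congr rfl fun jk _ => ?_
    have hW : taylor x (X ^ q - C β) = X ^ q + C (x - β) := by
      have h1 : (X + C x) ^ q = X ^ q + C x := by
        obtain ⟨p, _⟩ := CharP.exists F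
        have := Fact.mk (CharP.char_is_prime F p)
        obtain ⟨n, _, hn⟩ := FiniteField.card F p
        have hx : C x ^ q = C x := by rw [← C_pow, ← hq, FiniteField.pow_card]
        conv_rhs => rw [← hx]
        rw [← hq, hn, add_pow_char_pow]
      rw [map_sub, taylor_X_pow, taylor_C, h1, C_sub]
      ring
    rw [taylor_mul, taylor_pow, hW, coeff_mul_X_pow_add_C_pow _ _ _ _ _ (hi.trans_le hl),
      taylor_coeff]
  · refine natDegree_sum_le_of_forall_le _ _ fun jk _ => ?_
    have h1 : (P ^ (l + (q - 1) / m * (jk.1 : ℕ))).natDegree ≤ l * D + (q - 1) / m * jk.1 * D := by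
      refine natDegree_pow_le.trans ?_
      rw [← add_mul]
      exact Nat.mul_le_mul_left _ hPD
    have h2 : ((X ^ q - C β : F[X]) ^ (jk.2 : ℕ)).natDegree ≤ jk.2 * q := by
      refine natDegree_pow_le.trans ?_
      rw [natDegree_X_pow_sub_C]
    have h3 := hr jk
    have h4 : (q - 1) / m * jk.1 ≤ q := by
      refine (Nat.mul_le_mul_left _ jk.1.2.le).trans ((Nat.div_mul_le_self _ _).trans ?_)
      omega
    have h5 : (q - 1) / m * jk.1 * D ≤ D * q := by
      rw [mul_comm D]; exact Nat.mul_le_mul_right _ h4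
    have h6 : A ≤ q := by
      have := Nat.le_mul_of_pos_left (A + D) hm
      omega
    have h7 : (jk.2 : ℕ) * q + q ≤ K * q := by
      rw [← Nat.succ_mul]; exact Nat.mul_le_mul_right _ jk.2.2
    refine natDegree_mul_le.trans ?_
    have h8 := natDegree_mul_le (p := P ^ (l + (q - 1) / m * (jk.1 : ℕ))) (q := r jk)
    omega

set_option maxHeartbeats 1000000 in
theorem card_pow_eval_eq_mul_le {F : Type*} [Field F] [Fintype F] [DecidableEq F] {q m D : ℕ}
    (hq : Fintype.card F = q) (hm : 2 ≤ m) (hmq : m ∣ q - 1) (P : F[X]) (hP : P ≠ 0)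
    (hD : 1 ≤ D) (hPD : P.natDegree ≤ D)
    (hirr : ∀ s, 0 < s → s < m → ∃ α : AlgebraicClosure F,
      ¬ m ∣ s * (P.map (algebraMap F (AlgebraicClosure F))).rootMultiplicity α)
    (hs : 8 * m ^ 4 * D ≤ Nat.sqrt q) (w : F) :
    (Finset.univ.filter fun x : F => P.eval x ^ ((q - 1) / m) = w).card * m
      ≤ q + 37 * m ^ 2 * D * Nat.sqrt q := by
  obtain ⟨s, hsdef⟩ : ∃ s, s = Nat.sqrt q := ⟨_, rfl⟩
  have hs1 : s * s ≤ q := hsdef ▸ Nat.sqrt_le q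
  have hs2 : q ≤ s * s + s + s := hsdef ▸ Nat.sqrt_le_add q
  rw [← hsdef] at hs ⊢
  have hm1 : 1 ≤ m ^ 2 := Nat.one_le_pow _ _ (by omega)
  have hm4 : m * m ^ 3 = m ^ 4 := by ring
  have hm3 : m * m ^ 2 = m ^ 3 := by ring
  have hmm : 2 * 1 ≤ m ^ 2 := by nlinarith
  have hm3' : 2 ≤ m ^ 3 := by nlinarith
  obtain ⟨u, hu⟩ : ∃ u, u = 8 * m ^ 3 * D := ⟨_, rfl⟩
  have hum : m * u ≤ s := by 
    calc m * u = 8 * m ^ 4 * D := by rw [hu]; ring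
      _ ≤ s := hs
  have hmD : 8 * (m * D) ≤ s := by
    refine le_trans ?_ hs
    have : m ≤ m ^ 4 := Nat.le_self_pow (by norm_num) m
    nlinarith
  have hus : 2 * u ≤ s := by nlinarith
  have hspos : 16 ≤ s := by nlinarith
  have hDs : D ≤ s := by nlinarith
  have hsm : s ≤ m * s := Nat.le_mul_of_pos_left s (by omega)
  obtain ⟨l, hl⟩ : ∃ l, l + u = m * s := ⟨m * s - u, by omega⟩
  have hl2 : m * s ≤ 2 * l := by nlinarith
  obtain ⟨β, hβ⟩ : ∃ β, P.eval β ≠ 0 := by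
    by_contra! h
    refine hP (Polynomial.eq_zero_of_natDegree_lt_card_of_eval_eq_zero' P Finset.univ
      (fun i _ => h i) ?_)
    rw [Finset.card_univ, hq]
    nlinarith
  have hDq : D ≤ (q - 1) / m := by
    rw [Nat.le_div_iff_mul_le (by omega)]
    have : D * m + 1 ≤ q := by nlinarith
    omega
  obtain ⟨A, hA⟩ := Nat.exists_eq_add_of_le' hDq
  have hAm : m * (A + D) = q - 1 := by rw [← hA]; exact Nat.mul_div_cancel' hmq
  have hq1 : 1 ≤ q := by nlinarith
  have hAm' : m * (A + D) + 1 = q := by omega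
  have hls : l ≤ m * s := by omega
  have hlq : l ≤ q := by
    have hms : m ≤ s := by
      have := Nat.le_mul_of_pos_right m hD
      omega
    exact hls.trans ((Nat.mul_le_mul_right s hms).trans hs1)
  have hcount : l * (A + 1 + l * D + s) < m * s * (A + 1) := by
    rw [← hl, add_mul]
    suffices l * (l * D + s) < u * (A + 1) by nlinarith
    have h1 : l * (l * D + s) ≤ 2 * (m ^ 2 * D) * (s * s) := by
      calc l * (l * D + s) ≤ (m * s) * (m * s * D + s) := by gcongr
        _ ≤ (m * s) * (m * s * D + m * s * D) := by
          gcongr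
          have : 1 ≤ m * D := by nlinarith
          nlinarith
        _ = _ := by ring
    have h2 : u * (A + 1) = 8 * (m ^ 2 * D) * (m * (A + 1)) := by rw [hu]; ring
    have h3 : s * s < 4 * (m * (A + 1)) := by nlinarith
    have h4 : 0 < m ^ 2 * D := by positivity
    rw [h2]
    nlinarith
  have key := card_mul_le_of_stepanov hq (by omega) hmq P hPD hirr β hβ
    (A := A) (K := s) (l := l) (by omega) hlq hcount w
  set S := (Finset.univ.filter fun x : F => P.eval x ^ ((q - 1) / m) = w).card
  have hlpos : 0 < l := by nlinarith
  refine Nat.le_of_mul_le_mul_right (c := l) ?_ hlpos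
  have h1 : q * (u + m * D) ≤ 36 * m ^ 2 * D * s * l := by
    have hu' : u + m * D ≤ 9 * m ^ 3 * D := by
      rw [hu]
      have : m ≤ m ^ 3 := Nat.le_self_pow (by norm_num) m
      nlinarith
    have hq' : q ≤ 2 * (s * s) := by nlinarith
    calc q * (u + m * D) ≤ 2 * (s * s) * (9 * m ^ 3 * D) := by gcongr
      _ = 18 * m ^ 2 * D * s * (m * s) := by ring
      _ ≤ 18 * m ^ 2 * D * s * (2 * l) := by gcongr
      _ = _ := by ring
  have h2 : m * l * D ≤ m ^ 2 * D * s * l := by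
    have : m ≤ m ^ 2 * s := by nlinarith
    calc m * l * D = m * (D * l) := by ring
      _ ≤ m ^ 2 * s * (D * l) := by gcongr
      _ = _ := by ring
  calc S * m * l = m * (S * l) := by ring
    _ ≤ m * (l * D + D * q + s * q) := by gcongr
    _ = m * l * D + q * (m * D) + q * (m * s) := by ring
    _ = m * l * D + q * (u + m * D) + q * l := by rw [← hl]; ring
    _ ≤ m ^ 2 * D * s * l + 36 * m ^ 2 * D * s * l + q * l := by gcongr
    _ = _ := by ring

/-- The orbit of `1` under `x ↦ t * x ^ d + 1`, as polynomials in the parameter `t`. -/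
noncomputable def orbitPoly (R : Type*) [CommRing R] (d : ℕ) : ℕ → R[X]
  | 0 => 1
  | j + 1 => X * orbitPoly R d j ^ d + 1

/-- The degree of `orbitPoly R d j`. -/
def orbitDeg (d : ℕ) : ℕ → ℕ
  | 0 => 0
  | j + 1 => 1 + d * orbitDeg d j

/-- The polynomial in the parameter `t` that vanishes when the `j`-th orbit point is `ζ⁻¹`. -/
noncomputable def branchPoly {R : Type*} [CommRing R] (d j : ℕ) (ζ : R) : R[X] :=
  C ζ * orbitPoly R d j - 1

section CommRing

variable {R S : Type*} [CommRing R] [CommRing S]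

theorem map_orbitPoly (φ : R →+* S) (d j : ℕ) :
    (orbitPoly R d j).map φ = orbitPoly S d j := by
  induction j with
  | zero => simp [orbitPoly]
  | succ j ih => simp [orbitPoly, ih]

theorem map_branchPoly (φ : R →+* S) (d j : ℕ) (ζ : R) :
    (branchPoly d j ζ).map φ = branchPoly d j (φ ζ) := by
  simp [branchPoly, map_orbitPoly]

theorem eval_orbitPoly (d j : ℕ) (t : R) :
    (orbitPoly R d j).eval t = (fun x => t * x ^ d + 1)^[j] 1 := by
  induction j with
  | zero => simp [orbitPoly]
  | succ j ih => simp [orbitPoly, ih, Function.iterate_succ_apply']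

theorem eval_branchPoly (d j : ℕ) (ζ t : R) :
    (branchPoly d j ζ).eval t = ζ * (orbitPoly R d j).eval t - 1 := by
  simp [branchPoly]

theorem eval_zero_orbitPoly {d : ℕ} (j : ℕ) : (orbitPoly R d j).eval 0 = 1 := by
  cases j <;> simp [orbitPoly]

theorem branchPoly_succ {d : ℕ} (j : ℕ) (ζ : R) :
    branchPoly d (j + 1) ζ = C ζ * X * orbitPoly R d j ^ d + C (ζ - 1) := by
  simp only [branchPoly, orbitPoly, C_sub, C_1]
  ring

theorem derivative_branchPoly_succ {d : ℕ} (hd : 1 ≤ d) (j : ℕ) (ζ : R) :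
    derivative (branchPoly d (j + 1) ζ) = C ζ * orbitPoly R d j ^ (d - 1) *
      (orbitPoly R d j + (d : R[X]) * X * derivative (orbitPoly R d j)) := by
  have hQ : orbitPoly R d j ^ d = orbitPoly R d j ^ (d - 1) * orbitPoly R d j := by
    rw [← pow_succ, Nat.sub_add_cancel hd]
  rw [branchPoly_succ]
  simp only [derivative_add, derivative_mul, derivative_C, derivative_X, derivative_pow,
    C_eq_natCast]
  rw [hQ]
  ring

end CommRing

theorem one_le_orbitDeg {d j : ℕ} (hj : 1 ≤ j) : 1 ≤ orbitDeg d j := by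
  obtain ⟨k, rfl⟩ := Nat.exists_eq_add_of_le' hj
  simp [orbitDeg]

theorem orbitDeg_mono {d : ℕ} (hd : 1 ≤ d) : Monotone (orbitDeg d) :=
  monotone_nat_of_le_succ fun j => by
    have := Nat.le_mul_of_pos_left (orbitDeg d j) hd
    simp only [orbitDeg]
    omega

theorem orbitDeg_lt_pow {d : ℕ} (hd : 2 ≤ d) (j : ℕ) : orbitDeg d j < d ^ j := by
  induction j with
  | zero => simp [orbitDeg]
  | succ j ih =>
    simp only [orbitDeg, pow_succ]
    nlinarith

theorem sum_orbitDeg_lt {d : ℕ} (hd : 2 ≤ d) (n : ℕ) :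
    ∑ l ∈ Finset.Icc 1 n, orbitDeg d l < orbitDeg d (n + 1) := by
  induction n with
  | zero => simp [orbitDeg]
  | succ n ih =>
    rw [Finset.sum_Icc_succ_top (by omega)]
    have : orbitDeg d (n + 1 + 1) = 1 + d * orbitDeg d (n + 1) := rfl
    nlinarith

section Field

variable {L : Type*} [Field L] {d : ℕ}

theorem orbitPoly_ne_zero (j : ℕ) : orbitPoly L d j ≠ 0 := fun h => by
  simpa [h] using eval_zero_orbitPoly (R := L) (d := d) j

theorem natDegree_orbitPoly (j : ℕ) : (orbitPoly L d j).natDegree = orbitDeg d j := by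
  induction j with
  | zero => simp [orbitPoly, orbitDeg]
  | succ j ih =>
    rw [orbitPoly, ← C_1, natDegree_add_C, natDegree_X_mul (pow_ne_zero _ (orbitPoly_ne_zero j)),
      natDegree_pow, ih, orbitDeg, add_comm]

theorem natDegree_branchPoly {ζ : L} (hζ : ζ ≠ 0) (j : ℕ) :
    (branchPoly d j ζ).natDegree = orbitDeg d j := by
  rw [branchPoly, ← C_1, natDegree_sub_C, natDegree_C_mul hζ, natDegree_orbitPoly]

theorem eval_zero_branchPoly (j : ℕ) (ζ : L) : (branchPoly d j ζ).eval 0 = ζ - 1 := by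
  rw [eval_branchPoly, eval_zero_orbitPoly, mul_one]

theorem branchPoly_ne_zero {ζ : L} (hζ : ζ ≠ 1) (j : ℕ) : branchPoly d j ζ ≠ 0 := fun h => by
  have := eval_zero_branchPoly (d := d) j ζ
  rw [h, eval_zero] at this
  exact hζ (sub_eq_zero.1 this.symm)

theorem isPeriodicPt_of_isRoot_branchPoly {j : ℕ} {ζ t : L} (hζd : ζ ^ d = 1)
    (h : (branchPoly d j ζ).IsRoot t) :
    Function.IsPeriodicPt (fun x => t * x ^ d + 1) j (t + 1) := by
  have h1 : ζ * (orbitPoly L d j).eval t = 1 := by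
    rw [IsRoot.def, eval_branchPoly] at h
    exact sub_eq_zero.1 h
  have h2 : (orbitPoly L d j).eval t ^ d = 1 := by
    simpa [mul_pow, hζd] using congrArg (· ^ d) h1
  rw [eval_orbitPoly] at h2
  have h3 : (fun x => t * x ^ d + 1) (1 : L) = t + 1 := by simp
  rw [Function.IsPeriodicPt, Function.IsFixedPt, ← h3, ← Function.iterate_succ_apply,
    Function.iterate_succ_apply', h2]
  simp

/-- A common root of two branch polynomials of the levels `l < j` is already a root of a branch
polynomial of level at most `j / 2`. -/
theorem exists_isRoot_branchPoly_le_half {j l : ℕ} {ζ ξ t : L} (hl : 1 ≤ l) (hlj : l < j)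
    (hζd : ζ ^ d = 1) (hξd : ξ ^ d = 1) (h : (branchPoly d j ζ).IsRoot t)
    (h' : (branchPoly d l ξ).IsRoot t) :
    ∃ g ∈ Finset.Icc 1 (j / 2), (branchPoly d g ζ).IsRoot t := by
  have hp := (isPeriodicPt_of_isRoot_branchPoly hζd h).gcd
    (isPeriodicPt_of_isRoot_branchPoly hξd h')
  have hg1 : 1 ≤ j.gcd l := Nat.gcd_pos_of_pos_right _ hl
  have hgl : j.gcd l ≤ l := Nat.gcd_le_right _ hl
  obtain ⟨k, hk⟩ := Nat.gcd_dvd_left j l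
  set g := j.gcd l with hg
  have hk2 : 2 ≤ k := by
    by_contra! hk'
    interval_cases k <;> omega
  obtain ⟨k', rfl⟩ := Nat.exists_eq_add_of_le' (show 1 ≤ k by omega)
  refine ⟨g, Finset.mem_Icc.2 ⟨hg1, ?_⟩, ?_⟩
  · rw [Nat.le_div_iff_mul_le (by norm_num), hk]
    exact Nat.mul_le_mul_left g hk2
  · rw [IsRoot.def, eval_branchPoly] at h ⊢
    rw [← h]
    congr 2
    rw [eval_orbitPoly, eval_orbitPoly]
    obtain ⟨g', hg'⟩ := Nat.exists_eq_add_of_le' hg1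
    have e1 : j = (g' + g * k') + 1 := by rw [hk, mul_add, mul_one]; omega
    rw [e1, hg', Function.iterate_succ_apply, Function.iterate_succ_apply,
      Function.iterate_add_apply, ← hg', one_pow, mul_one]
    congr 1
    exact (hp.mul_const _).symm

/-- The cofactor of the trivial factors in the derivative of a branch polynomial. -/
noncomputable def branchDeriv (L : Type*) [Field L] (d j : ℕ) : L[X] :=
  orbitPoly L d j + (d : L[X]) * X * derivative (orbitPoly L d j)

theorem branchDeriv_ne_zero (j : ℕ) : branchDeriv L d j ≠ 0 := fun h => by
  have : (branchDeriv L d j).eval 0 = 1 := by simp [branchDeriv, eval_zero_orbitPoly]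
  simp [h] at this

theorem natDegree_branchDeriv_le {j : ℕ} (hj : 1 ≤ j) :
    (branchDeriv L d j).natDegree ≤ orbitDeg d j := by
  refine natDegree_add_le_of_degree_le (natDegree_orbitPoly j).le ?_
  have h1 := natDegree_derivative_le (orbitPoly L d j)
  rw [natDegree_orbitPoly] at h1
  have h2 := one_le_orbitDeg (d := d) hj
  rw [mul_assoc, ← C_eq_natCast]
  refine (natDegree_C_mul_le _ _).trans (natDegree_mul_le.trans ?_)
  rw [natDegree_X]
  omega

theorem branchPoly_dvd_of_forall_simple_root [IsAlgClosed L] {ζ : L} (hd : 2 ≤ d) (hζ0 : ζ ≠ 0)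
    (hζ : ζ ≠ 1) {n : ℕ} (P : L[X]) (hP : P ≠ 0)
    (h : ∀ α, (branchPoly d (n + 1) ζ).rootMultiplicity α = 1 → P.IsRoot α) :
    branchPoly d (n + 1) ζ ∣ branchDeriv L d n ^ 2 * P := by
  classical
  have hE := branchDeriv_ne_zero (L := L) (d := d) n
  have hR : branchDeriv L d n ^ 2 * P ≠ 0 := mul_ne_zero (pow_ne_zero _ hE) hP
  refine (IsAlgClosed.splits _).dvd_of_roots_le_roots (branchPoly_ne_zero hζ _) ?_
  rw [Multiset.le_iff_count]
  intro α
  rw [count_roots, count_roots, rootMultiplicity_mul hR, sq,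
    rootMultiplicity_mul (mul_ne_zero hE hE)]
  set k := (branchPoly d (n + 1) ζ).rootMultiplicity α with hk
  rcases Nat.lt_or_ge k 2 with hk2 | hk2
  · interval_cases hk' : k
    · exact Nat.zero_le _
    · have := (rootMultiplicity_pos hP).2 (h α hk.symm)
      omega
  · have hroot : (branchPoly d (n + 1) ζ).IsRoot α := by
      rw [← rootMultiplicity_pos (branchPoly_ne_zero hζ _)]
      omega
    have hQ : (orbitPoly L d n).eval α ≠ 0 := fun hQ => by
      rw [IsRoot.def, branchPoly_succ] at hroot
      simp only [eval_add, eval_mul, eval_pow, eval_C, hQ] at hroot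
      rw [zero_pow (by omega), mul_zero, zero_add] at hroot
      exact hζ (sub_eq_zero.1 hroot)
    have hdv : (X - C α) ^ (k - 1) ∣ derivative (branchPoly d (n + 1) ζ) :=
      pow_sub_one_dvd_derivative_of_pow_dvd (pow_rootMultiplicity_dvd _ _)
    rw [derivative_branchPoly_succ (by omega)] at hdv
    have hcop : IsCoprime ((X - C α) ^ (k - 1)) (C ζ * orbitPoly L d n ^ (d - 1)) := by
      refine IsCoprime.pow_left ((irreducible_X_sub_C α).coprime_iff_not_dvd.2 ?_)
      rw [dvd_iff_isRoot, IsRoot.def]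
      simp [hζ0, hQ]
    have := (le_rootMultiplicity_iff hE).2 (hcop.dvd_of_dvd_mul_left hdv)
    omega

theorem natDegree_prod_branchPoly_lt (hd : 2 ≤ d) {ζ : L} (hζ0 : ζ ≠ 0) (n : ℕ) :
    (∏ l ∈ Finset.Icc 1 n, branchPoly d l ζ).natDegree < orbitDeg d (n + 1) := by
  refine ((natDegree_prod_le _ _).trans_eq ?_).trans_lt (sum_orbitDeg_lt hd n)
  exact Finset.sum_congr rfl fun l _ => natDegree_branchPoly hζ0 l

theorem exists_orbitPoly_two_eq {n : ℕ} (hn : 2 ≤ n) :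
    ∃ T : L[X], orbitPoly L 2 n = 1 + X + 2 * X ^ 2 + X ^ 3 * T := by
  induction n, hn using Nat.le_induction with
  | base => exact ⟨1, by simp only [orbitPoly]; ring⟩
  | succ n _ ih =>
    obtain ⟨T, hT⟩ := ih
    refine ⟨5 + 4 * X + 4 * X ^ 2 + X * T * (2 + 2 * X + 4 * X ^ 2 + X ^ 3 * T), ?_⟩
    rw [orbitPoly, hT]
    ring

theorem two_eq_zero_of_branchDeriv_sq_mul_eq {n : ℕ} (hn : 2 ≤ n)
    (h : branchDeriv L 2 n ^ 2 * (X + 2) = X * orbitPoly L 2 n ^ 2 + 2) : (2 : L) = 0 := by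
  obtain ⟨T, hT⟩ := exists_orbitPoly_two_eq (L := L) hn
  obtain ⟨U, hU⟩ : ∃ U : L[X], branchDeriv L 2 n = 1 + 3 * X + 10 * X ^ 2 + X ^ 3 * U := by
    refine ⟨7 * T + 2 * X * derivative T, ?_⟩
    have : derivative (orbitPoly L 2 n)
        = 1 + 4 * X + 3 * X ^ 2 * T + X ^ 3 * derivative T := by
      have h2 : (2 : L[X]) = C 2 := rfl
      rw [hT, h2]
      simp only [derivative_add, derivative_one, derivative_X, derivative_C,
        derivative_X_pow, derivative_mul, Nat.cast_ofNat, pow_one, Nat.add_one_sub_one]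
      have h3 : (C 3 : L[X]) = 3 := rfl
      rw [← h2, h3]
      ring
    rw [branchDeriv, this, hT]
    push_cast
    ring
  rw [hT, hU] at h
  obtain ⟨V, hV⟩ : ∃ V : L[X], C 12 * X + C 62 * X ^ 2 = X ^ 3 * V := by
    have h12 : (C 12 : L[X]) = 12 := rfl
    have h62 : (C 62 : L[X]) = 62 := rfl
    rw [h12, h62]
    refine ⟨-144 - 4 * U - 256 * X + 2 * X * T - 14 * X * U - 96 * X ^ 2 + 2 * X ^ 2 * T
      - 46 * X ^ 2 * U + 4 * X ^ 3 * T - 20 * X ^ 3 * U - 2 * X ^ 3 * U ^ 2 + X ^ 4 * T ^ 2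
      - X ^ 4 * U ^ 2, ?_⟩
    linear_combination h
  have h1 := congrArg (fun p => coeff p 1) hV
  have h2 := congrArg (fun p => coeff p 2) hV
  simp [coeff_X_pow_mul', coeff_X_pow] at h1 h2
  linear_combination h2 - 5 * h1

theorem exists_simple_root_not_isRoot_prod [IsAlgClosed L] (hd : 2 ≤ d) {n : ℕ} (hn : 5 ≤ n)
    {ζ : L} (hζd : ζ ^ d = 1) (hζ : ζ ≠ 1) :
    ∃ α, (branchPoly d (n + 1) ζ).rootMultiplicity α = 1 ∧
      ¬ (∏ l ∈ Finset.Icc 1 ((n + 1) / 2), branchPoly d l ζ).IsRoot α := by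
  by_contra! hcon
  have hζ0 : ζ ≠ 0 := by
    rintro rfl
    rw [zero_pow (by omega)] at hζd
    exact zero_ne_one hζd
  set I := ∏ l ∈ Finset.Icc 1 ((n + 1) / 2), branchPoly d l ζ with hI
  have hI0 : I ≠ 0 := Finset.prod_ne_zero_iff.2 fun l _ => branchPoly_ne_zero hζ l
  have hIdeg : I.natDegree < orbitDeg d ((n + 1) / 2 + 1) := natDegree_prod_branchPoly_lt hd hζ0 _
  obtain ⟨b, hb⟩ := branchPoly_dvd_of_forall_simple_root hd hζ0 hζ I hI0 hcon
  have hE := branchDeriv_ne_zero (L := L) (d := d) n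
  have hb0 : b ≠ 0 := by
    rintro rfl
    rw [mul_zero] at hb
    exact mul_ne_zero (pow_ne_zero _ hE) hI0 hb
  have hdeg := congrArg natDegree hb
  rw [natDegree_mul (pow_ne_zero _ hE) hI0, natDegree_pow,
    natDegree_mul (branchPoly_ne_zero hζ _) hb0, natDegree_branchPoly hζ0] at hdeg
  have hEdeg := natDegree_branchDeriv_le (L := L) (d := d) (show 1 ≤ n by omega)
  have hstep : orbitDeg d (n + 1) = 1 + d * orbitDeg d n := rfl
  rcases Nat.lt_or_ge 2 d with hd3 | hd2
  · have hmono : orbitDeg d ((n + 1) / 2 + 1) ≤ orbitDeg d n :=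
      orbitDeg_mono (by omega) (by omega)
    nlinarith
  · obtain rfl : d = 2 := by omega
    obtain rfl : ζ = -1 := (sq_eq_one_iff.1 hζd).resolve_left hζ
    have h2 : (2 : L) ≠ 0 := fun h => hζ (by linear_combination -h)
    obtain ⟨k, rfl⟩ : ∃ k, n = k + 1 := ⟨n - 1, by omega⟩
    have hmono : orbitDeg 2 ((k + 1 + 1) / 2 + 1) ≤ orbitDeg 2 k :=
      orbitDeg_mono (by omega) (by omega)
    have hIb : I + (X + 2) * b = 0 := by
      refine eq_zero_of_dvd_of_natDegree_lt (p := orbitPoly L 2 k) ?_ ?_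
      · obtain ⟨Y, hY⟩ : ∃ Y, branchDeriv L 2 (k + 1) = 1 + orbitPoly L 2 k * Y := by
          refine ⟨X * orbitPoly L 2 k + 2 * X * (orbitPoly L 2 k
            + 2 * X * derivative (orbitPoly L 2 k)), ?_⟩
          simp only [branchDeriv, orbitPoly, derivative_add, derivative_mul, derivative_X,
            derivative_pow, derivative_one, C_eq_natCast]
          push_cast
          ring
        rw [hY, branchPoly_succ] at hb
        simp only [orbitPoly, C_sub, C_neg, C_1] at hb
        refine ⟨-(2 * Y + orbitPoly L 2 k * Y ^ 2) * I
          - b * X * (2 * X * orbitPoly L 2 k + X ^ 2 * orbitPoly L 2 k ^ 3), ?_⟩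
        linear_combination hb
      · rw [natDegree_orbitPoly]
        refine lt_of_le_of_lt ?_ (hIdeg.trans_le hmono)
        refine natDegree_add_le_of_degree_le le_rfl (natDegree_mul_le.trans ?_)
        have : (X + 2 : L[X]).natDegree = 1 := natDegree_X_add_C 2
        rw [this]
        omega
    refine h2 (two_eq_zero_of_branchDeriv_sq_mul_eq (n := k + 1) (by omega) ?_)
    refine mul_right_cancel₀ hb0 ?_
    rw [branchPoly_succ] at hb
    simp only [C_sub, C_neg, C_1] at hb
    linear_combination branchDeriv L 2 (k + 1) ^ 2 * hIb - hb

theorem exists_primitive_simple_root [IsAlgClosed L] (hd : 2 ≤ d) {j : ℕ} (hj : 6 ≤ j)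
    {ζ : L} (hζd : ζ ^ d = 1) (hζ : ζ ≠ 1) :
    ∃ α, α ≠ 0 ∧ (branchPoly d j ζ).rootMultiplicity α = 1 ∧
      ∀ l ξ, 1 ≤ l → l ≤ j → ξ ^ d = 1 → (l, ξ) ≠ (j, ζ) →
        ¬ (branchPoly d l ξ).IsRoot α := by
  obtain ⟨n, rfl⟩ : ∃ n, j = n + 1 := ⟨j - 1, by omega⟩
  obtain ⟨α, hα, hα'⟩ := exists_simple_root_not_isRoot_prod hd (n := n) (by omega) hζd hζ
  have hroot : (branchPoly d (n + 1) ζ).IsRoot α := by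
    rw [← rootMultiplicity_pos (branchPoly_ne_zero hζ _)]
    omega
  refine ⟨α, ?_, hα, fun l ξ hl hlj hξd hne hr => ?_⟩
  · rintro rfl
    rw [IsRoot.def, eval_zero_branchPoly] at hroot
    exact hζ (sub_eq_zero.1 hroot)
  · rcases hlj.eq_or_lt with rfl | hlt
    · refine hne (Prod.ext rfl ?_)
      rw [IsRoot.def, eval_branchPoly, sub_eq_zero] at hr hroot
      refine mul_right_cancel₀ (b := (orbitPoly L d (n + 1)).eval α) (fun h => ?_)
        (hr.trans hroot.symm)
      rw [h, mul_zero] at hr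
      exact zero_ne_one hr
    · obtain ⟨g, hg, hgr⟩ := exists_isRoot_branchPoly_le_half hl hlt hζd hξd hroot hr
      exact hα' (hgr.dvd (Finset.dvd_prod_of_mem _ hg))

end Field

theorem exists_primitive_quotient {ι : Type*} [Fintype ι] {e : ℕ} (he : 0 < e) (k : ι → ℕ)
    (hk : ∃ i, ¬ e ∣ k i) :
    ∃ (m g : ℕ) (k' : ι → ℕ), 2 ≤ m ∧ e = g * m ∧ (∀ i, k i = g * k' i) ∧
      ∀ s, 0 < s → s < m → ∃ i, ¬ m ∣ s * k' i := by
  set g := Nat.gcd e (Finset.univ.gcd k) with hg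
  obtain ⟨m, hm⟩ : g ∣ e := Nat.gcd_dvd_left _ _
  have hgk : ∀ i, g ∣ k i := fun i =>
    (Nat.gcd_dvd_right _ _).trans (Finset.gcd_dvd (Finset.mem_univ i))
  choose k' hk' using hgk
  have hg0 : 0 < g := Nat.gcd_pos_of_pos_left _ he
  have hm0 : m ≠ 0 := by
    rintro rfl
    omega
  refine ⟨m, g, k', ?_, hm, hk', fun s hs hsm => ?_⟩
  · by_contra! hm2
    obtain rfl : m = 1 := by omega
    obtain ⟨i, hi⟩ := hk
    exact hi (by rw [hm, mul_one]; exact ⟨_, hk' i⟩)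
  · by_contra! h
    have h1 : e ∣ s * Finset.univ.gcd k := by
      rw [← normalize_eq s, ← Finset.gcd_mul_left]
      refine Finset.dvd_gcd fun i _ => ?_
      obtain ⟨c, hc⟩ := h i
      exact ⟨c, by rw [hm, hk' i, mul_assoc, ← hc]; ring⟩
    have h2 : e ∣ s * g := by
      rw [hg, ← Nat.gcd_mul_left]
      exact Nat.dvd_gcd (dvd_mul_left _ _) h1
    rw [hm, mul_comm s] at h2
    exact absurd (Nat.le_of_dvd hs (Nat.dvd_of_mul_dvd_mul_left hg0 h2)) (by omega)

/-- The nontrivial `e`-th roots of unity. -/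
abbrev NontrivialRoot (F : Type*) [Field F] (e : ℕ) := {ζ : F // ζ ^ e = 1 ∧ ζ ≠ 1}

/-- The polynomial in `t` whose power residue character detects whether `ζ` times the orbit point
of level `6 + n` has a preimage under `x ↦ t * x ^ d + 1`. -/
noncomputable def residuePoly {F : Type*} [Field F] {J : ℕ} (d e : ℕ)
    (i : Fin J × NontrivialRoot F e) : F[X] :=
  branchPoly d (6 + i.1) i.2.1 * X ^ (e - 1)

section

variable {F : Type*} [Field F] {d e J : ℕ}

theorem residuePoly_ne_zero (i : Fin J × NontrivialRoot F e) : residuePoly d e i ≠ 0 :=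
  mul_ne_zero (branchPoly_ne_zero i.2.2.2 _) (pow_ne_zero _ X_ne_zero)

theorem natDegree_residuePoly_le (hd : 2 ≤ d) (he : 1 ≤ e) (hed : e ≤ d)
    (i : Fin J × NontrivialRoot F e) : (residuePoly d e i).natDegree ≤ 2 * d ^ (6 + (i.1 : ℕ)) := by
  have hζ0 : i.2.1 ≠ 0 := fun h => by
    have := i.2.2.1
    rw [h, zero_pow (by omega)] at this
    exact zero_ne_one this
  refine natDegree_mul_le.trans ?_
  rw [natDegree_X_pow, natDegree_branchPoly hζ0]
  have h1 := orbitDeg_lt_pow hd (6 + i.1)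
  have h2 : d ≤ d ^ (6 + (i.1 : ℕ)) := Nat.le_self_pow (by omega) d
  omega

theorem sum_pow_le_of_two_le (hd : 2 ≤ d) (a J : ℕ) :
    ∑ j : Fin J, d ^ (a + (j : ℕ)) ≤ d ^ (a + J) := by
  rw [Fin.sum_univ_eq_sum_range (fun j => d ^ (a + j)) J]
  induction J with
  | zero => simp
  | succ J ih =>
    rw [Finset.sum_range_succ, ← add_assoc, pow_succ]
    have := Nat.mul_le_mul_left (d ^ (a + J)) hd
    omega

variable [Fintype (NontrivialRoot F e)]

theorem natDegree_prod_residuePoly_pow_le (hd : 2 ≤ d) (he : 1 ≤ e) (hed : e ≤ d)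
    (hZ : Fintype.card (NontrivialRoot F e) ≤ d) (k : Fin J × NontrivialRoot F e → ℕ)
    (hk : ∀ i, k i ≤ e) :
    (∏ i, residuePoly d e i ^ k i).natDegree ≤ 2 * d ^ (8 + J) := by
  calc (∏ i, residuePoly d e i ^ k i).natDegree
      ≤ ∑ i, (residuePoly d e i ^ k i).natDegree := natDegree_prod_le _ _
    _ ≤ ∑ i : Fin J × NontrivialRoot F e, d * (2 * d ^ (6 + (i.1 : ℕ))) := by
        refine Finset.sum_le_sum fun i _ => natDegree_pow_le.trans ?_
        exact Nat.mul_le_mul ((hk i).trans hed) (natDegree_residuePoly_le hd he hed i)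
    _ = Fintype.card (NontrivialRoot F e) * (2 * d * ∑ j : Fin J, d ^ (6 + (j : ℕ))) := by
        rw [Fintype.sum_prod_type]
        simp only [Finset.sum_const, Finset.card_univ, smul_eq_mul]
        rw [← Finset.mul_sum]
        simp only [Finset.mul_sum]
        exact Finset.sum_congr rfl fun j _ => by ring
    _ ≤ d * (2 * d * d ^ (6 + J)) := by
        gcongr
        exact sum_pow_le_of_two_le hd 6 J
    _ = 2 * d ^ (8 + J) := by ring

theorem exists_not_dvd_rootMultiplicity_prod_residuePoly (L : Type*) [Field L] [Algebra F L]
    [IsAlgClosed L] (hd : 2 ≤ d) (hed : e ∣ d) {m s : ℕ} (k : Fin J × NontrivialRoot F e → ℕ)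
    (hk : ∃ i, ¬ m ∣ s * k i) :
    ∃ α : L, ¬ m ∣ s * ((∏ i, residuePoly d e i ^ k i).map
      (algebraMap F L)).rootMultiplicity α := by
  classical
  obtain ⟨i₁, hi₁⟩ := hk
  obtain ⟨i₀, hi₀, hmax⟩ := Finset.exists_max_image
    (Finset.univ.filter fun i => ¬ m ∣ s * k i) (fun i => (i.1 : ℕ)) ⟨i₁, by simpa using hi₁⟩
  have hpow : ∀ i : Fin J × NontrivialRoot F e, (algebraMap F L i.2.1) ^ d = 1 := fun i => by
    obtain ⟨c, rfl⟩ := hed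
    rw [← map_pow, pow_mul, i.2.2.1, one_pow, map_one]
  have hne1 : ∀ i : Fin J × NontrivialRoot F e, algebraMap F L i.2.1 ≠ 1 := fun i h =>
    i.2.2.2 ((algebraMap F L).injective (by rw [h, map_one]))
  obtain ⟨α, hα0, hα1, hα⟩ := exists_primitive_simple_root hd (j := 6 + i₀.1) (by omega)
    (hpow i₀) (hne1 i₀)
  refine ⟨α, ?_⟩
  have hmult : ∀ i : Fin J × NontrivialRoot F e,
      ((residuePoly d e i).map (algebraMap F L)).rootMultiplicity α
      = (branchPoly d (6 + i.1) (algebraMap F L i.2.1)).rootMultiplicity α := fun i => by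
    have h0 : ((residuePoly d e i).map (algebraMap F L)) ≠ 0 :=
      (Polynomial.map_ne_zero_iff (algebraMap F L).injective).2 (residuePoly_ne_zero i)
    have hX : ((X : L[X]) ^ (e - 1)).rootMultiplicity α = 0 := by
      refine rootMultiplicity_eq_zero ?_
      simp [IsRoot.def, hα0]
    rw [residuePoly, Polynomial.map_mul, map_branchPoly, Polynomial.map_pow, map_X] at h0 ⊢
    rw [rootMultiplicity_mul h0, hX, add_zero]
  have hsum : ((∏ i, residuePoly d e i ^ k i).map (algebraMap F L)).rootMultiplicity α
      = ∑ i, k i * (branchPoly d (6 + i.1) (algebraMap F L i.2.1)).rootMultiplicity α := by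
    have hne : ∀ i : Fin J × NontrivialRoot F e,
        (residuePoly d e i).map (algebraMap F L) ≠ 0 := fun i =>
      (Polynomial.map_ne_zero_iff (algebraMap F L).injective).2 (residuePoly_ne_zero i)
    rw [Polynomial.map_prod, ← count_roots, roots_prod _ _
      (Finset.prod_ne_zero_iff.2 fun i _ => by
        rw [Polynomial.map_pow]; exact pow_ne_zero _ (hne i)), Multiset.count_bind]
    rw [← Finset.sum_eq_multiset_sum]
    refine Finset.sum_congr rfl fun i _ => ?_
    rw [Polynomial.map_pow, roots_pow, Multiset.count_nsmul, count_roots, hmult i]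
  rw [hsum, Finset.mul_sum, ← Finset.add_sum_erase _ _ (Finset.mem_univ i₀), hα1, mul_one,
    Nat.dvd_add_left]
  · exact (Finset.mem_filter.1 hi₀).2
  · refine Finset.dvd_sum fun i hi => ?_
    by_cases hdvd : m ∣ s * k i
    · rw [← mul_assoc]
      exact hdvd.mul_right _
    · have hle : (i.1 : ℕ) ≤ i₀.1 := hmax i (by simpa using hdvd)
      rw [rootMultiplicity_eq_zero, mul_zero, mul_zero]
      · exact dvd_zero m
      · refine hα _ _ (by omega) (by omega) (hpow i) fun h => ?_
        rw [Prod.mk.injEq] at h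
        refine (Finset.mem_erase.1 hi).1 (Prod.ext (Fin.ext ?_) (Subtype.ext ?_))
        · omega
        · exact (algebraMap F L).injective h.2

end

section Character

variable {F : Type*} [Field F] [Fintype F] {q d e : ℕ} {χ : MulChar F ℂ}

theorem exists_generator_pow_of_orderOf_mulChar (hχ : orderOf χ = e) :
    ∃ γ : Fˣ, (∀ n, χ γ ^ n = 1 ↔ e ∣ n) ∧ ∀ x : F, x ≠ 0 → ∃ a : ℕ, x = (γ : F) ^ a := by
  obtain ⟨γ, hγ⟩ := IsCyclic.exists_generator (α := Fˣ)
  have hpow : ∀ x : Fˣ, ∃ a : ℕ, γ ^ a = x := fun x =>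
    Submonoid.mem_powers_iff x γ |>.1 (mem_powers_iff_mem_zpowers.2 (hγ x))
  refine ⟨γ, fun n => ?_, fun x hx => ?_⟩
  · rw [← hχ, orderOf_dvd_iff_pow_eq_one, MulChar.eq_iff hγ, MulChar.one_apply_coe,
      MulChar.pow_apply_coe]
  · obtain ⟨a, ha⟩ := hpow (Units.mk0 x hx)
    exact ⟨a, by rw [← Units.val_pow_eq_pow_val, ha, Units.val_mk0]⟩

theorem MulChar.apply_pow_orderOf (hχ : orderOf χ = e) {x : F} (hx : x ≠ 0) : χ x ^ e = 1 := by
  obtain ⟨γ, hγ, hp⟩ := exists_generator_pow_of_orderOf_mulChar hχ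
  obtain ⟨a, rfl⟩ := hp x hx
  rw [map_pow, ← pow_mul, hγ]
  exact dvd_mul_left _ _

theorem pow_eq_one_of_mulChar_pow_eq_one (hq : Fintype.card F = q) (heq : e ∣ q - 1)
    (he : 0 < e) (hχ : orderOf χ = e) {g m : ℕ} (hgm : e = g * m) {x : F} (hx : x ≠ 0)
    (h : χ x ^ g = 1) : x ^ ((q - 1) / m) = 1 := by
  obtain ⟨γ, hγ, hp⟩ := exists_generator_pow_of_orderOf_mulChar hχ
  obtain ⟨a, rfl⟩ := hp x hx
  have hg : 0 < g := Nat.pos_of_ne_zero (by rintro rfl; omega)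
  rw [map_pow, ← pow_mul, hγ, hgm, mul_comm a] at h
  obtain ⟨b, rfl⟩ := Nat.dvd_of_mul_dvd_mul_left hg h
  have hm : m ∣ q - 1 := (Dvd.intro_left g hgm.symm).trans heq
  have : m * b * ((q - 1) / m) = (q - 1) * b := by
    rw [mul_right_comm, Nat.mul_div_cancel' hm]
  rw [← pow_mul, this, pow_mul, ← hq, FiniteField.pow_card_sub_one_eq_one _ γ.ne_zero, one_pow]

theorem exists_pow_eq_iff_mulChar_eq_one (hq : Fintype.card F = q) (he : Nat.gcd d (q - 1) = e)
    (hχ : orderOf χ = e) {x : F} (hx : x ≠ 0) : (∃ y, y ^ d = x) ↔ χ x = 1 := by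
  constructor
  · rintro ⟨y, rfl⟩
    by_cases hd : d = 0
    · simp [hd]
    have hy : y ≠ 0 := by
      rintro rfl
      exact hx (zero_pow hd)
    obtain ⟨c, hc⟩ : e ∣ d := he ▸ Nat.gcd_dvd_left _ _
    rw [map_pow, hc, pow_mul, MulChar.apply_pow_orderOf hχ hy, one_pow]
  · intro h
    obtain ⟨γ, hγ, hp⟩ := exists_generator_pow_of_orderOf_mulChar hχ
    obtain ⟨a, rfl⟩ := hp x hx
    rw [map_pow, hγ] at h
    obtain ⟨b, rfl⟩ := h
    refine ⟨((γ ^ ((Nat.gcdA d (q - 1)) * b) : Fˣ) : F), ?_⟩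
    rw [← Units.val_pow_eq_pow_val, ← Units.val_pow_eq_pow_val, Units.val_inj,
      ← zpow_natCast, ← zpow_natCast, ← zpow_mul]
    have h1 : γ ^ ((q - 1 : ℕ) : ℤ) = 1 := by
      rw [zpow_natCast, Units.ext_iff, Units.val_pow_eq_pow_val, ← hq]
      exact FiniteField.pow_card_sub_one_eq_one _ γ.ne_zero
    have h2 : ((e * b : ℕ) : ℤ) = Nat.gcdA d (q - 1) * b * d
        + ((q - 1 : ℕ) : ℤ) * (Nat.gcdB d (q - 1) * b) := by
      rw [Nat.cast_mul, ← he, Nat.gcd_eq_gcd_ab]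
      ring
    rw [h2, zpow_add, zpow_mul γ ((q - 1 : ℕ) : ℤ), h1, one_zpow, mul_one]

end Character

section Fourier

variable {T : Type*}

theorem norm_sum_le_of_card_fiber_mul_le {m : ℕ} (hm : 2 ≤ m) (X : Finset T) (u : T → ℂ)
    (hu : ∀ t ∈ X, u t ^ m = 1) (Y : ℝ)
    (hY : ∀ v, ((X.filter fun t => u t = v).card : ℝ) * m ≤ Y) :
    ‖∑ t ∈ X, u t‖ ≤ Y - X.card := by
  classical
  have : NeZero m := ⟨by omega⟩
  have hω := Complex.isPrimitiveRoot_exp m (by omega)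
  set ω := Complex.exp (2 * Real.pi * Complex.I / m)
  have hinj : Set.InjOn (fun a => ω ^ a) (Finset.range m : Set ℕ) := fun a ha b hb h =>
    hω.pow_inj (Finset.mem_range.1 ha) (Finset.mem_range.1 hb) h
  set R := (Finset.range m).image fun a => ω ^ a with hR
  have hmap : ∀ t ∈ X, u t ∈ R := fun t ht => by
    obtain ⟨a, ha, h⟩ := hω.eq_pow_of_pow_eq_one (hu t ht)
    exact Finset.mem_image.2 ⟨a, Finset.mem_range.2 ha, h⟩
  have hRcard : R.card = m := by rw [hR, Finset.card_image_of_injOn hinj, Finset.card_range]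
  have hRsum : ∑ v ∈ R, v = 0 := by
    rw [hR, Finset.sum_image hinj]
    exact hω.geom_sum_eq_zero (by omega)
  have hm0 : (0 : ℝ) < m := by
    have : 0 < m := by omega
    exact_mod_cast this
  have hsum : ∑ t ∈ X, u t
      = -∑ v ∈ R, (((Y / m - (X.filter fun t => u t = v).card : ℝ)) : ℂ) * v := by
    rw [← Finset.sum_fiberwise_of_maps_to hmap]
    have h1 : ∀ v ∈ R, ∑ t ∈ X.filter (fun t => u t = v), u t
        = ((X.filter fun t => u t = v).card : ℂ) * v := fun v _ => by
      rw [Finset.sum_congr rfl fun t ht => (Finset.mem_filter.1 ht).2, Finset.sum_const,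
        nsmul_eq_mul]
    rw [Finset.sum_congr rfl h1]
    push_cast
    simp only [sub_mul, Finset.sum_sub_distrib]
    rw [← Finset.mul_sum, hRsum]
    ring
  have hXcard : (X.card : ℝ) = ∑ v ∈ R, ((X.filter fun t => u t = v).card : ℝ) := by
    rw [Finset.card_eq_sum_card_fiberwise hmap]
    push_cast
    rfl
  rw [hsum, norm_neg]
  refine (norm_sum_le _ _).trans ?_
  have h2 : ∀ v ∈ R, ‖(((Y / m - (X.filter fun t => u t = v).card : ℝ)) : ℂ) * v‖
      = Y / m - (X.filter fun t => u t = v).card := fun v hv => by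
    obtain ⟨a, _, rfl⟩ := Finset.mem_image.1 hv
    rw [norm_mul, norm_pow, hω.norm'_eq_one (by omega), one_pow, mul_one, Complex.norm_real,
      Real.norm_of_nonneg]
    rw [sub_nonneg, le_div_iff₀ hm0]
    exact hY _
  rw [Finset.sum_congr rfl h2, Finset.sum_sub_distrib, ← hXcard, Finset.sum_const, hRcard,
    nsmul_eq_mul, mul_div_cancel₀ _ hm0.ne']

theorem exists_forall_eq_of_norm_sum_le {ι : Type*} [Fintype ι] {e : ℕ} (he : 0 < e)
    (X : Finset T) (v : ι → T → ℂ) (hv : ∀ i, ∀ t ∈ X, v i t ^ e = 1) (τ : ι → ℂ)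
    (hτ : ∀ i, τ i ^ e = 1) (B : ℝ)
    (hB : ∀ k : ι → ℕ, (∀ i, k i < e) → k ≠ 0 → ‖∑ t ∈ X, ∏ i, v i t ^ k i‖ ≤ B)
    (hB0 : 0 ≤ B) (hX : (e : ℝ) ^ Fintype.card ι * B < X.card) :
    ∃ t ∈ X, ∀ i, v i t = τ i := by
  classical
  by_contra! hcon
  have hτ0 : ∀ i, τ i ≠ 0 := fun i h => by
    have := hτ i
    rw [h, zero_pow he.ne'] at this
    exact zero_ne_one this
  have hτn : ∀ i, ‖τ i‖ = 1 := fun i => Complex.norm_eq_one_of_pow_eq_one (hτ i) he.ne'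
  have hzero : ∀ t ∈ X, ∏ i, ∑ k ∈ Finset.range e, (v i t / τ i) ^ k = 0 := fun t ht => by
    obtain ⟨i, hi⟩ := hcon t ht
    refine Finset.prod_eq_zero (Finset.mem_univ i) ?_
    have h1 : v i t / τ i - 1 ≠ 0 := fun h =>
      hi (by rw [sub_eq_zero, div_eq_one_iff_eq (hτ0 i)] at h; exact h)
    have h2 := geom_sum_mul (v i t / τ i) e
    rw [div_pow, hv i t ht, hτ i, div_one, sub_self] at h2
    exact (mul_eq_zero.1 h2).resolve_right h1
  set Kset := Fintype.piFinset fun _ : ι => Finset.range e with hK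
  have htot : ∑ k ∈ Kset, (∏ i, (τ i)⁻¹ ^ k i) * ∑ t ∈ X, ∏ i, v i t ^ k i = 0 := by
    simp only [Finset.mul_sum]
    rw [Finset.sum_comm]
    refine Finset.sum_eq_zero fun t ht => ?_
    rw [← hzero t ht, Finset.prod_univ_sum]
    refine Finset.sum_congr rfl fun k _ => ?_
    rw [← Finset.prod_mul_distrib]
    refine Finset.prod_congr rfl fun i _ => ?_
    rw [div_eq_mul_inv, mul_comm, mul_pow]
  have h0 : (0 : ι → ℕ) ∈ Kset := by
    rw [hK, Fintype.mem_piFinset]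
    exact fun i => Finset.mem_range.2 he
  rw [← Finset.add_sum_erase _ _ h0] at htot
  simp only [Pi.zero_apply, pow_zero, Finset.prod_const_one, one_mul, Finset.sum_const,
    nsmul_eq_mul, mul_one] at htot
  have hle : (X.card : ℝ) ≤ ∑ k ∈ Kset.erase 0, B := by
    rw [← Complex.norm_natCast, eq_neg_of_add_eq_zero_left htot, norm_neg]
    refine (norm_sum_le _ _).trans (Finset.sum_le_sum fun k hk => ?_)
    obtain ⟨hk0, hk⟩ := Finset.mem_erase.1 hk
    have hn : ‖∏ i, (τ i)⁻¹ ^ k i‖ = 1 := by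
      rw [norm_prod]
      exact Finset.prod_eq_one fun i _ => by rw [norm_pow, norm_inv, hτn, inv_one, one_pow]
    rw [norm_mul, hn, one_mul]
    exact hB k (fun i => Finset.mem_range.1 (Fintype.mem_piFinset.1 hk i)) hk0
  have hcard : Kset.card = e ^ Fintype.card ι := by
    rw [hK, Fintype.card_piFinset]
    simp
  have h3 : (∑ k ∈ Kset.erase 0, B) ≤ (e : ℝ) ^ Fintype.card ι * B := by
    rw [Finset.sum_const, nsmul_eq_mul]
    refine mul_le_mul_of_nonneg_right ?_ hB0
    have : (Kset.erase 0).card ≤ e ^ Fintype.card ι := hcard ▸ Finset.card_erase_le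
    exact_mod_cast this
  linarith

end Fourier

section

variable {F : Type*} [Field F] [Fintype F] {q d e J : ℕ} {χ : MulChar F ℂ}
  [Fintype (NontrivialRoot F e)]

theorem norm_sum_prod_mulChar_residuePoly_le (hq : Fintype.card F = q) (hd : 2 ≤ d) (he : 2 ≤ e)
    (hed : e ∣ d) (heq : e ∣ q - 1) (hχ : orderOf χ = e)
    (hZ : Fintype.card (NontrivialRoot F e) ≤ d)
    (hs : 8 * e ^ 4 * (2 * d ^ (8 + J)) ≤ Nat.sqrt q) (X : Finset F)
    (hX : ∀ t ∈ X, ∀ i : Fin J × NontrivialRoot F e, (residuePoly d e i).eval t ≠ 0)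
    (k : Fin J × NontrivialRoot F e → ℕ) (hk : ∀ i, k i < e) (hk0 : k ≠ 0) :
    ‖∑ t ∈ X, ∏ i, χ ((residuePoly d e i).eval t) ^ k i‖
      ≤ q + 37 * e ^ 2 * (2 * d ^ (8 + J)) * Nat.sqrt q - X.card := by
  classical
  have hled : e ≤ d := Nat.le_of_dvd (by omega) hed
  obtain ⟨m, g, k', hm, hgm, hkk', hirr⟩ := exists_primitive_quotient (e := e) (by omega) k (by
    obtain ⟨i, hi⟩ := Function.ne_iff.1 hk0
    exact ⟨i, Nat.not_dvd_of_pos_of_lt (Nat.pos_of_ne_zero hi) (hk i)⟩)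
  have hg : 0 < g := Nat.pos_of_ne_zero (by rintro rfl; omega)
  have hme : m ≤ e := hgm ▸ Nat.le_mul_of_pos_left m hg
  have hk'e : ∀ i, k' i ≤ e := fun i =>
    (Nat.le_mul_of_pos_left _ hg).trans ((hkk' i).symm.trans_lt (hk i)).le
  set P : F[X] := ∏ i, residuePoly d e i ^ k' i with hP
  have hP0 : P ≠ 0 := Finset.prod_ne_zero_iff.2 fun i _ => pow_ne_zero _ (residuePoly_ne_zero i)
  have hPX : ∀ t ∈ X, P.eval t ≠ 0 := fun t ht => by
    rw [hP, eval_prod]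
    refine Finset.prod_ne_zero_iff.2 fun i _ => ?_
    rw [eval_pow]
    exact pow_ne_zero _ (hX t ht i)
  have hterm : ∀ t ∈ X, ∏ i, χ ((residuePoly d e i).eval t) ^ k i = χ (P.eval t) ^ g :=
    fun t _ => by
      rw [hP, eval_prod, map_prod, ← Finset.prod_pow]
      refine Finset.prod_congr rfl fun i _ => ?_
      rw [eval_pow, map_pow, ← pow_mul, hkk' i, mul_comm]
  rw [Finset.sum_congr rfl hterm]
  refine norm_sum_le_of_card_fiber_mul_le hm X _ (fun t ht => ?_) _ fun v => ?_
  · rw [← pow_mul, ← hgm]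
    exact MulChar.apply_pow_orderOf hχ (hPX t ht)
  · rcases (X.filter fun t => χ (P.eval t) ^ g = v).eq_empty_or_nonempty with hem | ⟨t₀, ht₀⟩
    · rw [hem]
      simp only [Finset.card_empty, Nat.cast_zero, zero_mul]
      positivity
    · obtain ⟨ht₀X, rfl⟩ := Finset.mem_filter.1 ht₀
      have hsub : (X.filter fun t => χ (P.eval t) ^ g = χ (P.eval t₀) ^ g) ⊆
          Finset.univ.filter fun x => P.eval x ^ ((q - 1) / m) = P.eval t₀ ^ ((q - 1) / m) := by
        intro t ht
        obtain ⟨htX, ht⟩ := Finset.mem_filter.1 ht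
        refine Finset.mem_filter.2 ⟨Finset.mem_univ _, ?_⟩
        have hne := div_ne_zero (hPX t htX) (hPX t₀ ht₀X)
        have h1 : χ (P.eval t / P.eval t₀) ^ g = 1 := by
          have h2 : χ (P.eval t / P.eval t₀) * χ (P.eval t₀) = χ (P.eval t) := by
            rw [← map_mul, div_mul_cancel₀ _ (hPX t₀ ht₀X)]
          rw [← h2, mul_pow] at ht
          refine mul_right_cancel₀ (b := χ (P.eval t₀) ^ g) (pow_ne_zero _ fun h0 => ?_)
            (ht.trans (one_mul _).symm)
          have := MulChar.apply_pow_orderOf hχ (hPX t₀ ht₀X)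
          rw [h0, zero_pow (by omega)] at this
          exact zero_ne_one this
        have h3 := pow_eq_one_of_mulChar_pow_eq_one hq heq (by omega) hχ hgm hne h1
        rwa [div_pow, div_eq_one_iff_eq (pow_ne_zero _ (hPX t₀ ht₀X))] at h3
      have hmain := card_pow_eval_eq_mul_le hq hm ((Dvd.intro_left g hgm.symm).trans heq) P hP0
        (D := 2 * d ^ (8 + J)) (by have := Nat.pow_pos (n := 8 + J) (show 0 < d by omega); omega)
        (natDegree_prod_residuePoly_pow_le hd (by omega) hled hZ k' hk'e)
        (fun s hs hsm => exists_not_dvd_rootMultiplicity_prod_residuePoly _ hd hed k'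
          (hirr s hs hsm)) (le_trans (by gcongr) hs) (P.eval t₀ ^ ((q - 1) / m))
      have hle := (Nat.mul_le_mul_right m (Finset.card_le_card hsub)).trans hmain
      have hle' : (X.filter fun t => χ (P.eval t) ^ g = χ (P.eval t₀) ^ g).card * m
          ≤ q + 37 * e ^ 2 * (2 * d ^ (8 + J)) * Nat.sqrt q := hle.trans (by gcongr)
      exact_mod_cast hle'

/-- For large `q`, every prescribed pattern of residue characters is attained. -/
theorem exists_param_of_residue_pattern (hq : Fintype.card F = q) (hd : 2 ≤ d) (he : 2 ≤ e)
    (hed : e ∣ d) (heq : e ∣ q - 1) (hχ : orderOf χ = e)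
    (hZ : Fintype.card (NontrivialRoot F e) = e - 1)
    (hs : 50 * e ^ (J * (e - 1) + 4) * (2 * d ^ (8 + J)) ≤ Nat.sqrt q)
    (τ : Fin J × NontrivialRoot F e → ℂ) (hτ : ∀ i, τ i ^ e = 1) :
    ∃ t : F, t ≠ 0 ∧ (∀ j : Fin J, (orbitPoly F d (6 + j)).eval t ≠ 0) ∧
      ∀ i : Fin J × NontrivialRoot F e, (branchPoly d (6 + i.1) i.2.1).eval t ≠ 0 ∧
        χ ((residuePoly d e i).eval t) = τ i := by
  classical
  have hled : e ≤ d := Nat.le_of_dvd (by omega) hed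
  have hZd : Fintype.card (NontrivialRoot F e) ≤ d := by omega
  set D := 2 * d ^ (8 + J) with hD
  have hD1 : d ^ (6 + J) + 1 ≤ D := by
    have h1 : d ^ (6 + J) ≤ d ^ (8 + J) := Nat.pow_le_pow_right (by omega) (by omega)
    have h2 := Nat.pow_pos (n := 8 + J) (show 0 < d by omega)
    omega
  set W : F[X] := X * (∏ j : Fin J, orbitPoly F d (6 + j)) *
    ∏ i : Fin J × NontrivialRoot F e, residuePoly d e i ^ 1 with hW
  have hW0 : W ≠ 0 := mul_ne_zero (mul_ne_zero X_ne_zero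
    (Finset.prod_ne_zero_iff.2 fun j _ => orbitPoly_ne_zero _))
    (Finset.prod_ne_zero_iff.2 fun i _ => pow_ne_zero _ (residuePoly_ne_zero i))
  have hWdeg : W.natDegree ≤ 3 * D := by
    have h1 : (∏ j : Fin J, orbitPoly F d (6 + j)).natDegree ≤ d ^ (6 + J) :=
      (natDegree_prod_le _ _).trans ((Finset.sum_le_sum fun j _ => by
        rw [natDegree_orbitPoly]
        exact (orbitDeg_lt_pow hd _).le).trans (sum_pow_le_of_two_le hd 6 J))
    have h2 := natDegree_prod_residuePoly_pow_le hd (by omega) hled hZd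
      (fun _ : Fin J × NontrivialRoot F e => 1) (fun _ => by omega)
    have h3 : (X * ∏ j : Fin J, orbitPoly F d (6 + j)).natDegree ≤ 1 + d ^ (6 + J) :=
      natDegree_mul_le.trans (by rw [natDegree_X]; omega)
    refine natDegree_mul_le.trans ?_
    omega
  set Xs : Finset F := Finset.univ.filter fun t => W.eval t ≠ 0 with hXs
  have hcard : q ≤ Xs.card + 3 * D := by
    have h1 := Finset.card_add_card_compl Xs
    have h2 : Xsᶜ.card ≤ 3 * D := by
      refine le_trans (Finset.card_le_card (t := W.roots.toFinset) fun t ht => ?_)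
        ((Multiset.toFinset_card_le _).trans ((card_roots' W).trans hWdeg))
      rw [Multiset.mem_toFinset, mem_roots hW0]
      simpa [hXs] using ht
    rw [hq] at h1
    omega
  have hgood : ∀ t ∈ Xs, t ≠ 0 ∧ (∀ j : Fin J, (orbitPoly F d (6 + j)).eval t ≠ 0) ∧
      ∀ i : Fin J × NontrivialRoot F e, (residuePoly d e i).eval t ≠ 0 := fun t ht => by
    have h1 := (Finset.mem_filter.1 ht).2
    rw [hW, eval_mul, eval_mul, eval_X, eval_prod, eval_prod] at h1
    have h2 := mul_ne_zero_iff.1 h1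
    have h3 := mul_ne_zero_iff.1 h2.1
    refine ⟨h3.1, fun j => Finset.prod_ne_zero_iff.1 h3.2 j (Finset.mem_univ j), fun i => ?_⟩
    have := Finset.prod_ne_zero_iff.1 h2.2 i (Finset.mem_univ i)
    rwa [pow_one] at this
  have hcardι : Fintype.card (Fin J × NontrivialRoot F e) = J * (e - 1) := by
    rw [Fintype.card_prod, Fintype.card_fin, hZ]
  obtain ⟨s, hsdef⟩ : ∃ s, s = Nat.sqrt q := ⟨_, rfl⟩
  have hss : s * s ≤ q := hsdef ▸ Nat.sqrt_le q
  have hN : 1 ≤ e ^ (J * (e - 1)) := Nat.one_le_pow _ _ (by omega)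
  rw [pow_add] at hs
  set N := e ^ (J * (e - 1)) with hNdef
  have he4 : 1 ≤ e ^ 4 := Nat.one_le_pow _ _ (by omega)
  have he2 : 1 ≤ e ^ 2 := Nat.one_le_pow _ _ (by omega)
  have hs8 : 8 * e ^ 4 * D ≤ Nat.sqrt q := by
    refine le_trans (Nat.mul_le_mul_right D ?_) hs
    calc 8 * e ^ 4 ≤ 50 * e ^ 4 := by omega
      _ = 50 * (1 * e ^ 4) := by ring
      _ ≤ 50 * (N * e ^ 4) := by gcongr
  have hmain : N * (37 * e ^ 2 * D * s + 3 * D) < Xs.card := by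
    rw [← hsdef] at hs
    set a := N * e ^ 2 * D with ha
    have hDpos : 1 ≤ D := by omega
    have ha1 : D ≤ a := by
      calc D = 1 * 1 * D := by ring
        _ ≤ a := by rw [ha]; gcongr
    have ha2 : N * D ≤ a := by
      calc N * D = N * 1 * D := by ring
        _ ≤ a := by rw [ha]; gcongr
    have ha3 : 50 * a ≤ s := by
      refine le_trans ?_ hs
      rw [ha, ← mul_assoc]
      gcongr
      exacts [by omega, by norm_num]
    have e1 : N * (37 * e ^ 2 * D * s + 3 * D) = 37 * (a * s) + 3 * (N * D) := by
      rw [ha]; ring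
    have h1 : 50 * a * s ≤ s * s := Nat.mul_le_mul_right s ha3
    have h2 : a * 50 ≤ a * s := Nat.mul_le_mul_left a (by omega)
    rw [e1]
    nlinarith
  obtain ⟨t, ht, hpat⟩ := exists_forall_eq_of_norm_sum_le (by omega : 0 < e) Xs
    (fun i t => χ ((residuePoly d e i).eval t))
    (fun i t ht => MulChar.apply_pow_orderOf hχ ((hgood t ht).2.2 i)) τ hτ
    (37 * e ^ 2 * D * s + 3 * D) (fun k hk hk0 => by
      refine (norm_sum_prod_mulChar_residuePoly_le hq hd he hed heq hχ hZd hs8 Xs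
        (fun t ht => (hgood t ht).2.2) k hk hk0).trans ?_
      have : (q : ℝ) ≤ Xs.card + 3 * D := by exact_mod_cast hcard
      rw [hsdef, hD] at *
      push_cast at this ⊢
      linarith) (by positivity) (by
      rw [hcardι]
      exact_mod_cast hmain)
  refine ⟨t, (hgood t ht).1, (hgood t ht).2.1, fun i => ⟨?_, hpat i⟩⟩
  have := (hgood t ht).2.2 i
  rw [residuePoly, eval_mul] at this
  exact left_ne_zero_of_mul this

end

section Conjugacy

/-- The number of preimages of the `(j + 1)`-st orbit point of `v`, other than the `j`-th orbit
point, which themselves have a preimage. -/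
noncomputable def branchCount {V : Type*} (f : V → V) (v : V) (j : ℕ) : ℕ :=
  Set.ncard {y | f y = f^[j + 1] v ∧ y ≠ f^[j] v ∧ ∃ x, f x = y}

theorem branchCount_eq_of_semiconj {V W : Type*} {f : V → V} {g : W → W} (σ : V ≃ W)
    (h : Function.Semiconj σ f g) (v : V) (j : ℕ) :
    branchCount f v j = branchCount g (σ v) j := by
  have hit : ∀ n, g^[n] (σ v) = σ (f^[n] v) := fun n => ((h.iterate_right n) v).symm
  rw [branchCount, branchCount, ← Set.ncard_image_of_injective _ σ.injective]
  congr 1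
  ext w
  obtain ⟨y, rfl⟩ := σ.surjective w
  rw [σ.injective.mem_set_image, Set.mem_ofPred_eq, Set.mem_ofPred_eq, hit, hit, ← h.eq,
    σ.injective.eq_iff, σ.injective.ne_iff]
  refine and_congr_right fun _ => and_congr_right fun _ => ⟨?_, ?_⟩
  · rintro ⟨x, hx⟩
    exact ⟨σ x, by rw [← h.eq, hx]⟩
  · rintro ⟨x, hx⟩
    obtain ⟨x, rfl⟩ := σ.surjective x
    exact ⟨x, σ.injective (by rw [h.eq, hx])⟩

theorem Function.Semiconj.existsUnique_preimage {V W : Type*} {f : V → V} {g : W → W} (σ : V ≃ W)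
    (h : Function.Semiconj σ f g) {y : V} (hy : ∃! x, f x = y) : ∃! x, g x = σ y := by
  obtain ⟨x, hx, hu⟩ := hy
  refine ⟨σ x, by simp only [← h.eq, hx], fun w hw => ?_⟩
  obtain ⟨z, rfl⟩ := σ.surjective w
  simp only [← h.eq, σ.injective.eq_iff] at hw
  rw [hu z hw]

variable {F : Type*} [Field F] {d : ℕ}

theorem existsUnique_mul_pow_add_one_eq_iff (hd : d ≠ 0) {ζ t : F} (hζd : ζ ^ d = 1) (hζ : ζ ≠ 1)
    (ht : t ≠ 0) (y : F) : (∃! x, t * x ^ d + 1 = y) ↔ y = 1 := by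
  constructor
  · rintro ⟨x, hx, hu⟩
    have h1 : ζ * x = x := hu _ (by simp only [mul_pow, hζd, one_mul]; exact hx)
    have h2 : x = 0 := by
      by_contra h0
      exact hζ (mul_right_cancel₀ h0 (h1.trans (one_mul x).symm))
    rw [← hx, h2, zero_pow hd, mul_zero, zero_add]
  · rintro rfl
    refine ⟨0, by simp [hd], fun x hx => ?_⟩
    simpa [ht, hd] using hx

theorem equiv_one_eq_one_of_semiconj (hd : d ≠ 0) {ζ s t : F} (hζd : ζ ^ d = 1) (hζ : ζ ≠ 1)
    (hs : s ≠ 0) (ht : t ≠ 0) (σ : F ≃ F)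
    (h : Function.Semiconj σ (fun x => s * x ^ d + 1) fun x => t * x ^ d + 1) : σ 1 = 1 :=
  (existsUnique_mul_pow_add_one_eq_iff hd hζd hζ ht _).1
    (h.existsUnique_preimage σ ((existsUnique_mul_pow_add_one_eq_iff hd hζd hζ hs _).2 rfl))

variable [Fintype F] {q e J : ℕ} {χ : MulChar F ℂ}

theorem exists_mul_pow_add_one_eq_iff (hq : Fintype.card F = q) (he : Nat.gcd d (q - 1) = e)
    (he0 : 0 < e) (hχ : orderOf χ = e) {t : F} (ht : t ≠ 0) (i : Fin J × NontrivialRoot F e)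
    (hi : (branchPoly d (6 + i.1) i.2.1).eval t ≠ 0) :
    (∃ x, t * x ^ d + 1 = i.2.1 * (orbitPoly F d (6 + i.1)).eval t) ↔
      χ ((residuePoly d e i).eval t) = 1 := by
  have hH : (branchPoly d (6 + i.1) i.2.1).eval t / t ≠ 0 := div_ne_zero hi ht
  have h1 : (residuePoly d e i).eval t
      = (branchPoly d (6 + i.1) i.2.1).eval t / t * t ^ e := by
    obtain ⟨k, rfl⟩ := Nat.exists_eq_add_of_le' he0
    rw [residuePoly, eval_mul, eval_pow, eval_X, pow_succ, Nat.succ_sub_one]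
    field_simp
  rw [h1, map_mul, map_pow, MulChar.apply_pow_orderOf hχ ht, mul_one,
    ← exists_pow_eq_iff_mulChar_eq_one hq he hχ hH]
  refine exists_congr fun x => ?_
  rw [eval_branchPoly, eq_div_iff ht, eq_sub_iff_add_eq, mul_comm t]

theorem branchCount_eq_card (hq : Fintype.card F = q) (he : Nat.gcd d (q - 1) = e) (hd : d ≠ 0)
    (he0 : 0 < e) (hχ : orderOf χ = e) {t : F} (ht : t ≠ 0) (j : Fin J)
    (hQ : (orbitPoly F d (6 + j)).eval t ≠ 0)
    (hH : ∀ ζ : NontrivialRoot F e, (branchPoly d (6 + j) ζ.1).eval t ≠ 0) :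
    branchCount (fun x => t * x ^ d + 1) 1 (6 + j)
      = Set.ncard {ζ : NontrivialRoot F e | χ ((residuePoly d e (j, ζ)).eval t) = 1} := by
  set Q := (orbitPoly F d (6 + j)).eval t with hQdef
  have hinj : Function.Injective fun ζ : NontrivialRoot F e => ζ.1 * Q := fun ζ ξ h =>
    Subtype.ext (mul_right_cancel₀ hQ h)
  rw [branchCount, ← Set.ncard_image_of_injective _ hinj]
  congr 1
  ext y
  rw [Set.mem_ofPred_eq, Function.iterate_succ_apply', ← eval_orbitPoly, ← hQdef, Set.mem_image]
  constructor
  · rintro ⟨h1, h2, h3⟩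
    have h4 : (y / Q) ^ d = 1 := by
      rw [div_pow, div_eq_one_iff_eq (pow_ne_zero _ hQ)]
      exact mul_left_cancel₀ ht (add_right_cancel h1)
    have hy : y / Q ≠ 0 := fun h => by
      rw [h, zero_pow hd] at h4
      exact zero_ne_one h4
    have h5 : (y / Q) ^ e = 1 := by
      rw [← he, pow_gcd_eq_one]
      exact ⟨h4, by rw [← hq]; exact FiniteField.pow_card_sub_one_eq_one _ hy⟩
    have h6 : y / Q * Q = y := div_mul_cancel₀ _ hQ
    let ζ : NontrivialRoot F e := ⟨y / Q, h5, fun h => h2 ((div_eq_one_iff_eq hQ).1 h)⟩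
    refine ⟨ζ, (exists_mul_pow_add_one_eq_iff hq he he0 hχ ht (j, ζ) (hH ζ)).1 ?_, h6⟩
    simp only [← hQdef]
    rw [h6]
    exact h3
  · rintro ⟨ζ, hζ, rfl⟩
    have hpre := (exists_mul_pow_add_one_eq_iff hq he he0 hχ ht (j, ζ) (hH ζ)).2 hζ
    have hζd : ζ.1 ^ d = 1 := by
      obtain ⟨c, hc⟩ : e ∣ d := he ▸ Nat.gcd_dvd_left _ _
      rw [hc, pow_mul, ζ.2.1, one_pow]
    refine ⟨by simp only [mul_pow, hζd, one_mul], fun h => ζ.2.2 ?_, hpre⟩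
    exact mul_right_cancel₀ hQ (h.trans (one_mul Q).symm)

theorem exists_isPrimitiveRoot_of_dvd_card_sub_one (hq : Fintype.card F = q) (heq : e ∣ q - 1) :
    ∃ ω : F, IsPrimitiveRoot ω e := by
  classical
  obtain ⟨γ, hγ⟩ := IsCyclic.exists_generator (α := Fˣ)
  have h1 := IsPrimitiveRoot.orderOf γ
  rw [orderOf_eq_card_of_forall_mem_zpowers hγ, Nat.card_eq_fintype_card, Fintype.card_units,
    hq] at h1
  obtain ⟨c, hc⟩ := heq
  have hpos : 0 < q - 1 := by
    have := Fintype.one_lt_card (α := F)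
    omega
  exact ⟨_, IsPrimitiveRoot.coe_units_iff.2 (h1.pow hpos (hc.trans (mul_comm _ _)))⟩

theorem card_nontrivialRoot [Fintype (NontrivialRoot F e)] (hq : Fintype.card F = q)
    (heq : e ∣ q - 1) (he : 0 < e) : Fintype.card (NontrivialRoot F e) = e - 1 := by
  classical
  obtain ⟨ω, hω⟩ := exists_isPrimitiveRoot_of_dvd_card_sub_one hq heq
  rw [Fintype.card_of_subtype ((nthRootsFinset e (1 : F)).erase 1), Finset.card_erase_of_mem,
    hω.card_nthRootsFinset]
  · rw [mem_nthRootsFinset he, one_pow]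
  · intro x
    rw [Finset.mem_erase, mem_nthRootsFinset he, and_comm]

end Conjugacy

theorem equivalence_polyFunRel (F : Type) [Field F] (d : ℕ) : Equivalence (polyFunRel F d) where
  refl f := ⟨Equiv.refl F, rfl⟩
  symm := by
    rintro f g ⟨σ, h⟩
    refine ⟨σ.symm, funext fun x => ?_⟩
    have := congrFun h (σ.symm x)
    simp only [Function.comp_apply, Equiv.apply_symm_apply] at this ⊢
    rw [← this, Equiv.symm_apply_apply]
  trans := by
    rintro f g k ⟨σ, h⟩ ⟨ρ, h'⟩
    refine ⟨σ.trans ρ, ?_⟩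
    rw [Equiv.coe_trans, Function.comp_assoc, h, ← Function.comp_assoc, h', Function.comp_assoc]

theorem finite_quot_polyFunRel (F : Type) [Field F] [Finite F] (d : ℕ) :
    Finite (Quot (polyFunRel F d)) := by
  refine Finite.of_injective
    (fun c : Quot (polyFunRel F d) => fun x : F => c.out.1.eval x) fun a b h => ?_
  rw [← Quot.out_eq a, ← Quot.out_eq b]
  exact Quot.sound ⟨Equiv.refl F, h⟩

theorem pow_le_numFunctionalGraphs {F : Type} [Field F] [Fintype F] {q d e J : ℕ}
    (hq : Fintype.card F = q) (hd : 2 ≤ d) (he : 2 ≤ e) (hgcd : Nat.gcd d (q - 1) = e)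
    (hs : 50 * e ^ (J * (e - 1) + 4) * (2 * d ^ (8 + J)) ≤ Nat.sqrt q) :
    e ^ J ≤ numFunctionalGraphs F d := by
  classical
  have hed : e ∣ d := hgcd ▸ Nat.gcd_dvd_left _ _
  have heq : e ∣ q - 1 := hgcd ▸ Nat.gcd_dvd_right _ _
  have : Fintype (NontrivialRoot F e) := Fintype.ofFinite _
  have hω := Complex.isPrimitiveRoot_exp e (by omega)
  set ω := Complex.exp (2 * Real.pi * Complex.I / e)
  have hω1 : ω ≠ 1 := hω.ne_one (by omega)
  obtain ⟨χ, hχ⟩ := MulChar.exists_mulChar_orderOf F (hq.symm ▸ heq) hω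
  have hZ := card_nontrivialRoot (F := F) hq heq (by omega)
  obtain ⟨ζ₀, hζ₀⟩ := exists_isPrimitiveRoot_of_dvd_card_sub_one (F := F) hq heq
  have hζ₀d : ζ₀ ^ d = 1 := by
    obtain ⟨c, rfl⟩ := hed
    rw [pow_mul, hζ₀.pow_eq_one, one_pow]
  have hexists : ∀ c : Fin J → Fin e, ∃ t : F, t ≠ 0 ∧
      ∀ j : Fin J, branchCount (fun x => t * x ^ d + 1) 1 (6 + j) = c j := by
    intro c
    have hS : ∀ j, ∃ S : Finset (NontrivialRoot F e), S.card = c j := fun j => by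
      obtain ⟨S, -, hS⟩ := Finset.exists_subset_card_eq
        (s := (Finset.univ : Finset (NontrivialRoot F e))) (n := c j)
        (by rw [Finset.card_univ, hZ]; omega)
      exact ⟨S, hS⟩
    choose S hS using hS
    obtain ⟨t, ht, hQ, hH⟩ := exists_param_of_residue_pattern hq hd he hed heq hχ hZ hs
      (fun i => if i.2 ∈ S i.1 then 1 else ω) (fun i => by
        split_ifs
        exacts [one_pow e, hω.pow_eq_one])
    refine ⟨t, ht, fun j => ?_⟩
    rw [branchCount_eq_card hq hgcd (by omega) (by omega) hχ ht j (hQ j)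
      (fun ζ => (hH (j, ζ)).1), ← hS j, ← Set.ncard_coe_finset]
    congr 1
    ext ζ
    rw [Set.mem_ofPred_eq, (hH (j, ζ)).2, Finset.mem_coe]
    simp [hω1]
  choose t ht hcount using hexists
  have hdeg : ∀ c, (C (t c) * X ^ d + 1 : F[X]).natDegree = d := fun c => by
    rw [← C_1, natDegree_add_C, natDegree_C_mul_X_pow d _ (ht c)]
  have := finite_quot_polyFunRel F d
  have hinj : Function.Injective fun c : Fin J → Fin e =>
      (Quot.mk (polyFunRel F d) ⟨C (t c) * X ^ d + 1, hdeg c⟩) := by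
    intro c c' h
    obtain ⟨σ, hσ⟩ := (equivalence_polyFunRel F d).eqvGen_iff.1 (Quot.eqvGen_exact h)
    have hsemi : Function.Semiconj σ (fun x => t c * x ^ d + 1) fun x => t c' * x ^ d + 1 :=
      fun x => by simpa using congrFun hσ x
    have h1 := equiv_one_eq_one_of_semiconj (by omega) hζ₀d (hζ₀.ne_one (by omega)) (ht c)
      (ht c') σ hsemi
    funext j
    refine Fin.ext ?_
    rw [← hcount c j, ← hcount c' j, branchCount_eq_of_semiconj σ hsemi, h1]
  calc e ^ J = Nat.card (Fin J → Fin e) := by simp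
    _ ≤ numFunctionalGraphs F d := Nat.card_le_card_of_injective _ hinj

theorem rpow_le_mul_pow_of_le_mul_pow {q C d e k : ℕ} (hC : 1 ≤ C) (he : 2 ≤ e) (hed : e ≤ d)
    (h : q ≤ (C * (e ^ (e - 1) * d) ^ k) ^ 2) :
    (q : ℝ) ^ ((1 : ℝ) / (2 * ((e : ℝ) - 1 + Real.log d / Real.log e))) ≤ C * (e : ℝ) ^ k := by
  have he' : (2 : ℝ) ≤ e := by exact_mod_cast he
  have hd' : (e : ℝ) ≤ d := by exact_mod_cast hed
  have hC' : (1 : ℝ) ≤ C := by exact_mod_cast hC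
  have hloge : 0 < Real.log e := Real.log_pos (by linarith)
  have hlogd : 0 ≤ Real.log d := Real.log_nonneg (by linarith)
  set θ : ℝ := (e : ℝ) - 1 + Real.log d / Real.log e with hθ
  have hθ1 : 1 ≤ θ := by
    have : 0 ≤ Real.log d / Real.log e := by positivity
    linarith
  have hB : ((e : ℝ) ^ (e - 1) * d) = (e : ℝ) ^ θ := by
    rw [hθ, Real.rpow_add (by linarith), ← Real.rpow_natCast, Nat.cast_sub (by omega),
      Nat.cast_one]
    congr 1
    rw [Real.rpow_def_of_pos (by linarith), mul_div_cancel₀ _ hloge.ne',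
      Real.exp_log (by linarith)]
  have hq : (q : ℝ) ≤ (C * ((e : ℝ) ^ θ) ^ k) ^ 2 := by
    rw [← hB]
    exact_mod_cast h
  calc (q : ℝ) ^ ((1 : ℝ) / (2 * θ))
      ≤ ((C * ((e : ℝ) ^ θ) ^ k) ^ 2) ^ ((1 : ℝ) / (2 * θ)) := by gcongr
    _ = (C : ℝ) ^ (1 / θ) * (e : ℝ) ^ k := by
      have h0 : (0 : ℝ) ≤ e := by linarith
      rw [← Real.rpow_natCast _ 2, ← Real.rpow_mul (by positivity),
        Real.mul_rpow (by positivity) (by positivity), ← Real.rpow_natCast _ k,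
        ← Real.rpow_mul h0, ← Real.rpow_mul h0, ← Real.rpow_natCast _ k]
      congr 2
      · push_cast
        field_simp
      · push_cast
        field_simp
    _ ≤ C * (e : ℝ) ^ k := by
      gcongr
      calc (C : ℝ) ^ (1 / θ) ≤ (C : ℝ) ^ (1 : ℝ) :=
            Real.rpow_le_rpow_of_exponent_le hC' ((div_le_one (by linarith)).2 hθ1)
        _ = C := Real.rpow_one _

theorem stmt4 (d : ℕ) (hd : 2 ≤ d) (ε : ℝ) (hε : 0 < ε) :
    ∃ Q : ℕ, ∀ (F : Type) (_ : Field F) (_ : Fintype F) (q : ℕ),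
      q = Fintype.card F → Q < q →
      Nat.gcd (d - 1) q = 1 → 2 ≤ Nat.gcd d (q - 1) →
      (q : ℝ) ^
          ((1 : ℝ) / (2 * ((Nat.gcd d (q - 1) : ℝ) - 1 +
            Real.log d / Real.log (Nat.gcd d (q - 1)))) - ε)
        ≤ (numFunctionalGraphs F d : ℝ) := by
  obtain ⟨C, hCdef⟩ : ∃ C, C = 100 * d ^ 12 := ⟨_, rfl⟩
  have hC : 1 ≤ C := by
    have := Nat.pow_pos (n := 12) (show 0 < d by omega)
    omega
  refine ⟨max (C * C) ⌈((C * d : ℕ) : ℝ) ^ (1 / ε)⌉₊, fun F _ _ q hq hQ _ he => ?_⟩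
  obtain ⟨e, hedef⟩ : ∃ e, e = Nat.gcd d (q - 1) := ⟨_, rfl⟩
  rw [← hedef] at he ⊢
  have hed : e ≤ d := hedef ▸ Nat.gcd_le_left _ (by omega)
  have hs : C ≤ Nat.sqrt q := Nat.le_sqrt.2 ((le_max_left _ _).trans hQ.le)
  obtain ⟨B, hB⟩ : ∃ B, B = e ^ (e - 1) * d := ⟨_, rfl⟩
  have hB1 : 1 < B := by
    have := Nat.one_le_pow (e - 1) e (by omega)
    rw [hB]
    nlinarith
  obtain ⟨J, hJ⟩ : ∃ J, J = Nat.log B (Nat.sqrt q / C) := ⟨_, rfl⟩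
  have hlow : C * B ^ J ≤ Nat.sqrt q := by
    have h1 : B ^ J ≤ Nat.sqrt q / C :=
      hJ ▸ Nat.pow_log_le_self B (Nat.div_pos hs (by omega)).ne'
    rw [mul_comm]
    exact (Nat.le_div_iff_mul_le (by omega)).1 h1
  have hhigh : Nat.sqrt q < C * B ^ (J + 1) := by
    have h1 : Nat.sqrt q / C < B ^ (J + 1) := hJ ▸ Nat.lt_pow_succ_log_self hB1 _
    rw [mul_comm]
    exact (Nat.div_lt_iff_lt_mul (by omega)).1 h1
  have hmany : e ^ J ≤ numFunctionalGraphs F d := by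
    refine pow_le_numFunctionalGraphs hq.symm hd he hedef.symm (le_trans ?_ hlow)
    calc 50 * e ^ (J * (e - 1) + 4) * (2 * d ^ (8 + J))
        = 100 * (e ^ 4 * d ^ 8) * B ^ J := by
          rw [hB, mul_pow, ← pow_mul, mul_comm (e - 1), pow_add, pow_add]
          ring
      _ ≤ 100 * (d ^ 4 * d ^ 8) * B ^ J := by gcongr
      _ = C * B ^ J := by rw [hCdef]; ring
  have hqle : q ≤ (C * (e ^ (e - 1) * d) ^ (J + 1)) ^ 2 := by
    rw [← hB, sq]
    have h1 : q < (Nat.sqrt q + 1) * (Nat.sqrt q + 1) := Nat.lt_succ_sqrt q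
    exact h1.le.trans (Nat.mul_le_mul hhigh hhigh)
  have hmain := rpow_le_mul_pow_of_le_mul_pow hC he hed hqle
  have hq0 : 0 < q := by omega
  have hq0' : (0 : ℝ) < q := by exact_mod_cast hq0
  have hqε : ((C * d : ℕ) : ℝ) ≤ (q : ℝ) ^ ε := by
    have h1 : ((C * d : ℕ) : ℝ) ^ (1 / ε) ≤ q :=
      (Nat.le_ceil _).trans (by exact_mod_cast (le_max_right _ _).trans hQ.le)
    calc ((C * d : ℕ) : ℝ) = (((C * d : ℕ) : ℝ) ^ (1 / ε)) ^ ε := by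
          rw [← Real.rpow_mul (Nat.cast_nonneg _), one_div_mul_cancel hε.ne', Real.rpow_one]
      _ ≤ (q : ℝ) ^ ε := by gcongr
  rw [Real.rpow_sub hq0', div_le_iff₀ (by positivity)]
  calc _ ≤ C * (e : ℝ) ^ (J + 1) := hmain
    _ = (e : ℝ) ^ J * (C * e) := by ring
    _ ≤ (numFunctionalGraphs F d : ℝ) * (q : ℝ) ^ ε := by
      gcongr
      · exact_mod_cast hmany
      · refine le_trans ?_ hqε
        push_cast
        gcongr
end
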